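/- arXiv:2603.24380 — 3 statements merged into one kernel-verified Lean document; each statement's English description precedes it below -/
import Mathlib

section
/- Interpolation estimates for the first-order expansion coefficients (Lemma 3.2 of the paper, stated in conditional form with exactly the hypotheses these coefficients enjoy): Let α ∈ (0,1), let k ≥ 4 be an integer, and let C₀ > 0. Suppose u : ℝ^d × ℝ → ℝ is smooth and for every t ≥ 1 satisfies (i) sup_{Q_ρ(t)} |u| ≤ C₀ e^{−2t}, (ii) [𝔇⁴u]_{α,Q_ρ(t)} ≤ C₀ e^{−t}, and (iii) [𝔇^ℓ u]_{α,Q_ρ(t)} ≤ C₀ e^{(ℓ−6)t/2} for every integer 4 ≤ ℓ ≤ 2k+6. Then there exists C > 0 such that for every t ≥ 1: sup_{Q_{ρ′}(t)} |𝔇^ℓ u| ≤ C e^{−(t/2)(4 − 2ℓ/(4+α))} for every integer 0 ≤ ℓ ≤ 4, and sup_{Q_{ρ′}(t)} |𝔇^ℓ u| ≤ C e^{−(t/2)(4 − ℓ(ℓ−2)/(ℓ+α))} for every integer 4 ≤ ℓ ≤ 2k+6. -/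
open Real Finset

/-- The `p`-th spatial Fréchet derivative of the `q`-th time derivative of
`u : ℝ^d × ℝ → ℝ` (space is the first variable, time the second). -/
noncomputable def spaceTimeDeriv (d : ℕ) (u : EuclideanSpace ℝ (Fin d) × ℝ → ℝ)
    (p q : ℕ) (x : EuclideanSpace ℝ (Fin d)) (s : ℝ) :
    ContinuousMultilinearMap ℝ (fun _ : Fin p => EuclideanSpace ℝ (Fin d)) ℝ :=
  iteratedFDeriv ℝ p (fun y => iteratedDeriv q (fun τ => u (y, τ)) s) x

/-- `|𝔇^k u (z)| = sqrt (Σ_{p+2q=k} ‖D_x^p ∂_t^q u(z)‖²)`. -/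
noncomputable def frakDNorm (d : ℕ) (u : EuclideanSpace ℝ (Fin d) × ℝ → ℝ)
    (k : ℕ) (z : EuclideanSpace ℝ (Fin d) × ℝ) : ℝ :=
  Real.sqrt (∑ q ∈ Finset.range (k / 2 + 1), ‖spaceTimeDeriv d u (k - 2 * q) q z.1 z.2‖ ^ 2)

/-- The parabolic cylinder `Q_ρ(t) = {(x,s) : |x| ≤ ρ, t-1 ≤ s ≤ t}`. -/
def parabolicCylinder (d : ℕ) (ρ t : ℝ) : Set (EuclideanSpace ℝ (Fin d) × ℝ) :=
  {z | ‖z.1‖ ≤ ρ ∧ t - 1 ≤ z.2 ∧ z.2 ≤ t}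

/-- The parabolic distance `|x-x'| + |s-s'|^{1/2}`. -/
noncomputable def parabolicDist (d : ℕ) (z w : EuclideanSpace ℝ (Fin d) × ℝ) : ℝ :=
  ‖z.1 - w.1‖ + |z.2 - w.2| ^ ((1 : ℝ) / 2)

/-- `[𝔇^k u]_{α,Q} ≤ B`: the sum over the components `D_x^{k-2q} ∂_t^q u` of their
parabolic `α`-Hölder seminorms over `Q` is at most `B`. -/
def frakDHolderLE (d : ℕ) (u : EuclideanSpace ℝ (Fin d) × ℝ → ℝ) (k : ℕ) (α : ℝ)
    (Q : Set (EuclideanSpace ℝ (Fin d) × ℝ)) (B : ℝ) : Prop :=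
  ∃ M : ℕ → ℝ, (∀ q, 0 ≤ M q) ∧ (∑ q ∈ Finset.range (k / 2 + 1), M q) ≤ B ∧
    ∀ q ∈ Finset.range (k / 2 + 1), ∀ z ∈ Q, ∀ w ∈ Q,
      ‖spaceTimeDeriv d u (k - 2 * q) q z.1 z.2 - spaceTimeDeriv d u (k - 2 * q) q w.1 w.2‖
        ≤ M q * parabolicDist d z w ^ α

open scoped ContDiff

section diff
variable {V : Type*} [NormedAddCommGroup V] [NormedSpace ℝ V]

/-- Iterated directional derivative along a list of vectors. -/
noncomputable def dd : List V → (V → ℝ) → V → ℝ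
  | [], f => f
  | w :: l, f => fun z => fderiv ℝ (dd l f) z w

/-- Iterated finite difference along a list of vectors. -/
def dl : List V → (V → ℝ) → V → ℝ
  | [], f => f
  | w :: l, f => dl l (fun z => f (z + w) - f z)

/-- The parallelepiped spanned by a list of vectors, based at a point. -/
def pbox : List V → V → Set V
  | [], z => {z}
  | w :: l, z => {y | ∃ t : ℝ, 0 ≤ t ∧ t ≤ 1 ∧ ∃ x ∈ pbox l z, y = x + t • w}

theorem dd_smooth (l : List V) (f : V → ℝ) (hf : ContDiff ℝ ∞ f) : ContDiff ℝ ∞ (dd l f) := by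
  induction l with
  | nil => exact hf
  | cons w l ih =>
    have : ContDiff ℝ ∞ (fderiv ℝ (dd l f)) := ih.fderiv_right (by simp)
    exact this.clm_apply contDiff_const

theorem dd_shift (l : List V) (f : V → ℝ) (hf : ContDiff ℝ ∞ f) (w z : V) :
    dd l (fun z => f (z + w) - f z) z = dd l f (z + w) - dd l f z := by
  induction l generalizing z with
  | nil => rfl
  | cons a l ih =>
    have h1 : dd l (fun z => f (z + w) - f z) = fun z => dd l f (z + w) - dd l f z := funext ih
    have hd : Differentiable ℝ (dd l f) := (dd_smooth l f hf).differentiable (by simp)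
    simp only [dd, h1]
    have hd2 : DifferentiableAt ℝ (fun z => dd l f (z + w)) z :=
      (hd (z + w)).comp z (by fun_prop : DifferentiableAt ℝ (fun z => z + w) z)
    rw [fderiv_fun_sub hd2 (hd z), fderiv_comp_add_right]
    rfl

theorem dl_mvt (l : List V) (f : V → ℝ) (hf : ContDiff ℝ ∞ f) (z : V) :
    ∃ y ∈ pbox l z, dl l f z = dd l f y := by
  induction l generalizing f with
  | nil => exact ⟨z, rfl, rfl⟩
  | cons w l ih =>
    obtain ⟨x, hx, he⟩ := ih (fun z => f (z + w) - f z)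
      ((hf.comp (contDiff_id.add contDiff_const)).sub hf)
    rw [dd_shift l f hf] at he
    have hd : Differentiable ℝ (dd l f) := (dd_smooth l f hf).differentiable (by simp)
    have hder : ∀ t : ℝ, HasDerivAt (fun t : ℝ => dd l f (x + t • w))
        (fderiv ℝ (dd l f) (x + t • w) w) t := by
      intro t
      have h1 : HasDerivAt (fun t : ℝ => x + t • w) w t := by
        simpa using ((hasDerivAt_id t).smul_const w).const_add x
      exact (hd (x + t • w)).hasFDerivAt.comp_hasDerivAt t h1
    obtain ⟨t, ht, hte⟩ := exists_hasDerivAt_eq_slope (fun t : ℝ => dd l f (x + t • w))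
      (fun t => fderiv ℝ (dd l f) (x + t • w) w) zero_lt_one
      (fun t _ => (hder t).continuousAt.continuousWithinAt) (fun t _ => hder t)
    refine ⟨x + t • w, ⟨t, ht.1.le, ht.2.le, x, hx, rfl⟩, ?_⟩
    simp only [dl, dd]
    rw [he, hte]
    simp

theorem dl_bound (l : List V) (f : V → ℝ) (z : V) (A : ℝ)
    (h : ∀ y ∈ pbox l z, |f y| ≤ A) : |dl l f z| ≤ 2 ^ l.length * A := by
  induction l generalizing f A with
  | nil => simpa [dl] using h z rfl
  | cons w l ih =>
    have := ih (fun z => f (z + w) - f z) (2 * A) (by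
      intro y hy
      have h1 := h (y + w) ⟨1, by norm_num, le_refl _, y, hy, by simp⟩
      have h2 := h y ⟨0, le_refl _, by norm_num, y, hy, by simp⟩
      have := abs_sub (f (y + w)) (f y)
      linarith)
    simp only [dl, List.length_cons]
    rw [pow_succ, mul_assoc]
    exact this

end diff

section st
variable {d : ℕ}
local notation "E" => EuclideanSpace ℝ (Fin d)

theorem dd_time (u : E × ℝ → ℝ) (hu : ContDiff ℝ ∞ u) (c : ℝ) (q : ℕ) (y : E) (s : ℝ) :
    dd (List.replicate q ((0 : E), c)) u (y, s) = c ^ q * iteratedDeriv q (fun τ => u (y, τ)) s := by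
  induction q generalizing s with
  | zero => simp [dd]
  | succ q ih =>
    have hd : Differentiable ℝ (dd (List.replicate q ((0 : E), c)) u) :=
      (dd_smooth _ u hu).differentiable (by simp)
    have h1 : HasDerivAt (fun τ : ℝ => dd (List.replicate q ((0 : E), c)) u (y, τ))
        (fderiv ℝ (dd (List.replicate q ((0 : E), c)) u) (y, s) (0, 1)) s :=
      (hd (y, s)).hasFDerivAt.comp_hasDerivAt s ((hasDerivAt_const s y).prodMk (hasDerivAt_id s))
    have h2 : (fun τ : ℝ => dd (List.replicate q ((0 : E), c)) u (y, τ))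
      = fun τ => c ^ q * iteratedDeriv q (fun τ => u (y, τ)) τ := funext fun τ => ih τ
    rw [h2] at h1
    have h3 : ContDiff ℝ ∞ (fun τ => u (y, τ)) := hu.comp (contDiff_const.prodMk contDiff_id)
    have h4 := (((h3.differentiable_iteratedDeriv q (by exact_mod_cast WithTop.coe_lt_top _)) s).hasDerivAt).const_mul (c ^ q)
    have h5 := h1.unique h4
    simp only [List.replicate_succ, dd]
    have h6 : ((0 : E), c) = c • ((0 : E), (1 : ℝ)) := by simp
    rw [h6, map_smul, ← h6, h5, iteratedDeriv_succ, smul_eq_mul, pow_succ]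
    ring

theorem dd_space (u : E × ℝ → ℝ) (hu : ContDiff ℝ ∞ u) (p : ℕ) (v : Fin p → E) (y : E) (s : ℝ) :
    dd ((List.ofFn v).map (fun w => (w, (0 : ℝ)))) u (y, s)
      = iteratedFDeriv ℝ p (fun y => u (y, s)) y v := by
  induction p generalizing y with
  | zero => simp [dd]
  | succ p ih =>
    rw [iteratedFDeriv_succ_apply_left, List.ofFn_succ, List.map_cons]
    simp only [dd]
    have hG : ContDiff ℝ ∞ (fun y => u (y, s)) := hu.comp (contDiff_id.prodMk contDiff_const)
    set l := (List.ofFn fun i : Fin p => v i.succ).map (fun w => (w, (0 : ℝ))) with hl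
    have hd : Differentiable ℝ (dd l u) := (dd_smooth _ u hu).differentiable (by simp)
    have h1 : HasFDerivAt (fun y : E => dd l u (y, s))
        ((fderiv ℝ (dd l u) (y, s)).comp ((ContinuousLinearMap.id ℝ E).prod 0)) y :=
      (hd (y, s)).hasFDerivAt.comp y ((hasFDerivAt_id y).prodMk (hasFDerivAt_const s y))
    have h2 : (fun y : E => dd l u (y, s)) = fun y => iteratedFDeriv ℝ p (fun y => u (y, s)) y (Fin.tail v) :=
      funext fun y => ih (fun i => v i.succ) y
    rw [h2] at h1
    have h3 : DifferentiableAt ℝ (iteratedFDeriv ℝ p (fun y => u (y, s))) y :=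
      (hG.differentiable_iteratedFDeriv (by exact_mod_cast WithTop.coe_lt_top _)) y
    have h4 := (ContinuousMultilinearMap.apply ℝ (fun _ : Fin p => E) ℝ (Fin.tail v)).hasFDerivAt.comp y h3.hasFDerivAt
    have h5 := DFunLike.congr_fun (h1.unique h4) (v 0)
    simpa using h5

theorem dd_append {V : Type*} [NormedAddCommGroup V] [NormedSpace ℝ V] (a b : List V) (f : V → ℝ) :
    dd (a ++ b) f = dd a (dd b f) := by
  induction a with
  | nil => rfl
  | cons w a ih => simp only [List.cons_append, dd, ih]

theorem dd_full (u : E × ℝ → ℝ) (hu : ContDiff ℝ ∞ u) (p q : ℕ) (c : ℝ) (v : Fin p → E) (y : E) (s : ℝ) :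
    dd ((List.ofFn v).map (fun w => (w, (0 : ℝ))) ++ List.replicate q ((0 : E), c)) u (y, s)
      = c ^ q * spaceTimeDeriv d u p q y s v := by
  rw [dd_append, dd_space _ (dd_smooth _ _ hu)]
  simp only [dd_time u hu]
  unfold spaceTimeDeriv
  have hU : ContDiff ℝ ∞ (fun y => iteratedDeriv q (fun τ => u (y, τ)) s) := by
    have h1 : (fun y : E => iteratedDeriv q (fun τ => u (y, τ)) s) =
        fun y => dd (List.replicate q ((0 : E), (1:ℝ))) u (y, s) := by
      funext y; rw [dd_time u hu]; simp
    rw [h1]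
    exact (dd_smooth _ u hu).comp (contDiff_id.prodMk contDiff_const)
  have := iteratedFDeriv_const_smul_apply (𝕜 := ℝ) (i := p) (a := c ^ q) (x := y)
    ((hU.of_le (by exact_mod_cast le_top)).contDiffAt (n := p))
  have h2 := DFunLike.congr_fun this v
  simpa [Pi.smul_def] using h2

theorem box_space (z : E × ℝ) (l0 : List (E × ℝ)) (r : ℝ) (p : ℕ) (v : Fin p → E)
    (hv : ∀ i, ‖v i‖ ≤ r) (ξ : E × ℝ)
    (h : ξ ∈ pbox ((List.ofFn v).map (fun w => (w, (0 : ℝ))) ++ l0) z) :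
    ∃ η ∈ pbox l0 z, ‖ξ.1 - η.1‖ ≤ p * r ∧ ξ.2 = η.2 := by
  induction p generalizing ξ with
  | zero => exact ⟨ξ, by simpa using h, by simp, rfl⟩
  | succ p ih =>
    rw [List.ofFn_succ, List.map_cons, List.cons_append] at h
    obtain ⟨t, ht0, ht1, x, hx, rfl⟩ := h
    obtain ⟨η, h1, h2, h3⟩ := ih _ (fun i => hv i.succ) x hx
    refine ⟨η, h1, ?_, by simpa using h3⟩
    have : (x + t • (v 0, (0 : ℝ))).1 - η.1 = (x.1 - η.1) + t • v 0 := by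
      simp; abel
    rw [this]
    refine (norm_add_le _ _).trans ?_
    rw [norm_smul, Real.norm_of_nonneg ht0]
    have := hv 0
    have h5 : t * ‖v 0‖ ≤ 1 * r := mul_le_mul ht1 this (norm_nonneg _) zero_le_one
    push_cast
    linarith

theorem box_time (z : E × ℝ) (c : ℝ) (q : ℕ) (ξ : E × ℝ)
    (h : ξ ∈ pbox (List.replicate q ((0 : E), c)) z) :
    ξ.1 = z.1 ∧ ∃ τ : ℝ, 0 ≤ τ ∧ τ ≤ q ∧ ξ.2 = z.2 + τ * c := by
  induction q generalizing ξ with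
  | zero => 
    have : ξ = z := by simpa [pbox] using h
    subst this
    exact ⟨rfl, 0, by simp⟩
  | succ q ih =>
    rw [List.replicate_succ] at h
    obtain ⟨t, ht0, ht1, x, hx, rfl⟩ := h
    obtain ⟨h1, τ, h2, h3, h4⟩ := ih x hx
    refine ⟨by simpa using h1, τ + t, by linarith, by push_cast; linarith, ?_⟩
    simp [h4]; ring

/-- Key finite-difference estimate. -/
theorem key_est (u : E × ℝ → ℝ) (hu : ContDiff ℝ ∞ u) (p q : ℕ) (x : E) (s r c A δ : ℝ)
    (hr : 0 < r) (hδ : 0 ≤ δ) (hc : c ≠ 0)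
    (hA : ∀ y : E, ∀ τ : ℝ, ‖y - x‖ ≤ p * r → 0 ≤ τ → τ ≤ q → |u (y, s + τ * c)| ≤ A)
    (hosc : ∀ y : E, ∀ τ : ℝ, ‖y - x‖ ≤ p * r → 0 ≤ τ → τ ≤ q →
      ‖spaceTimeDeriv d u p q y (s + τ * c) - spaceTimeDeriv d u p q x s‖ ≤ δ) :
    r ^ p * |c| ^ q * ‖spaceTimeDeriv d u p q x s‖ ≤ 2 ^ (p + q) * A + r ^ p * |c| ^ q * δ := by
  have hA0 : 0 ≤ A := (abs_nonneg _).trans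
    (hA x 0 (by simp; positivity) le_rfl (by positivity))
  have hcp : 0 < |c| ^ q := by positivity
  -- bound for vectors of norm at most r
  have main : ∀ v : Fin p → E, (∀ i, ‖v i‖ ≤ r) →
      |c| ^ q * |spaceTimeDeriv d u p q x s v| ≤ 2 ^ (p + q) * A + |c| ^ q * (δ * r ^ p) := by
    intro v hv
    set l := (List.ofFn v).map (fun w => (w, (0 : ℝ))) ++ List.replicate q ((0 : E), c) with hl
    have hbox : ∀ ξ ∈ pbox l (x, s), ‖ξ.1 - x‖ ≤ p * r ∧ ∃ τ : ℝ, 0 ≤ τ ∧ τ ≤ q ∧ ξ.2 = s + τ * c := by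
      intro ξ hξ
      obtain ⟨η, h1, h2, h3⟩ := box_space _ _ r p v hv ξ hξ
      obtain ⟨h4, τ, h5, h6, h7⟩ := box_time _ _ _ _ h1
      refine ⟨by simpa [h4] using h2, τ, h5, h6, by rw [h3, h7]⟩
    obtain ⟨ξ, hξ, he⟩ := dl_mvt l u hu (x, s)
    have hb := dl_bound l u (x, s) A (by
      rintro ⟨y, σ⟩ hy
      obtain ⟨h1, τ, h2, h3, h4⟩ := hbox _ hy
      simp only at h4 h1
      rw [h4]
      exact hA y τ h1 h2 h3)
    have hlen : l.length = p + q := by simp [hl]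
    rw [he, hlen] at hb
    obtain ⟨y, σ⟩ := ξ
    obtain ⟨h1, τ, h2, h3, h4⟩ := hbox _ hξ
    simp only at h4 h1
    rw [hl, dd_full u hu, h4, abs_mul, abs_pow] at hb
    have ho := hosc y τ h1 h2 h3
    have ho2 := (spaceTimeDeriv d u p q y (s + τ * c) - spaceTimeDeriv d u p q x s).le_opNorm v
    have hprod : ∏ i, ‖v i‖ ≤ r ^ p := by
      calc ∏ i, ‖v i‖ ≤ ∏ i : Fin p, r := Finset.prod_le_prod (fun _ _ => norm_nonneg _) (fun i _ => hv i)
        _ = r ^ p := by simp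
    have ho3 : |spaceTimeDeriv d u p q y (s + τ * c) v - spaceTimeDeriv d u p q x s v| ≤ δ * r ^ p := by
      refine le_trans ?_ (ho2.trans (mul_le_mul ho hprod (Finset.prod_nonneg fun _ _ => norm_nonneg _) hδ))
      simp
    have ho4 : |spaceTimeDeriv d u p q x s v| ≤ |spaceTimeDeriv d u p q y (s + τ * c) v| + δ * r ^ p := by
      have := abs_sub_abs_le_abs_sub (spaceTimeDeriv d u p q x s v) (spaceTimeDeriv d u p q y (s + τ * c) v)
      rw [abs_sub_comm] at this
      linarith
    have := mul_le_mul_of_nonneg_left ho4 hcp.le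
    linarith
  have hrp : 0 < r ^ p := by positivity
  have hK0 : 0 ≤ (2 ^ (p + q) * A + r ^ p * |c| ^ q * δ) / (r ^ p * |c| ^ q) := by positivity
  have : ‖spaceTimeDeriv d u p q x s‖ ≤ (2 ^ (p + q) * A + r ^ p * |c| ^ q * δ) / (r ^ p * |c| ^ q) := by
    refine ContinuousMultilinearMap.opNorm_le_bound hK0 ?_
    intro m
    by_cases hm : ∃ i, m i = 0
    · obtain ⟨i, hi⟩ := hm
      rw [(spaceTimeDeriv d u p q x s).map_coord_zero i hi, norm_zero]
      positivity
    · push Not at hm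
      have hmm : m = fun i => (‖m i‖ / r) • ((r / ‖m i‖) • m i) := by
        funext i
        have := norm_ne_zero_iff.2 (hm i)
        rw [smul_smul, div_mul_div_comm, mul_comm, div_self (by positivity), one_smul]
      have h1 := main (fun i => (r / ‖m i‖) • m i) (by
        intro i
        have := norm_ne_zero_iff.2 (hm i)
        rw [norm_smul, norm_div, norm_norm, Real.norm_of_nonneg hr.le, div_mul_cancel₀ _ this])
      have h2 : spaceTimeDeriv d u p q x s m = (∏ i, (‖m i‖ / r)) *
          spaceTimeDeriv d u p q x s (fun i => (r / ‖m i‖) • m i) := by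
        conv_lhs => rw [hmm]
        rw [ContinuousMultilinearMap.map_smul_univ, smul_eq_mul]
      have h3 : ∏ i, (‖m i‖ / r) = (∏ i, ‖m i‖) / r ^ p := by
        rw [Finset.prod_div_distrib]; simp
      rw [h2, norm_mul, h3, Real.norm_of_nonneg (by positivity), Real.norm_eq_abs]
      have h4 : |spaceTimeDeriv d u p q x s (fun i => (r / ‖m i‖) • m i)| ≤
          (2 ^ (p + q) * A + |c| ^ q * (δ * r ^ p)) / |c| ^ q := by
        rw [le_div_iff₀ hcp]; linarith
      calc _ ≤ (∏ i, ‖m i‖) / r ^ p * ((2 ^ (p + q) * A + |c| ^ q * (δ * r ^ p)) / |c| ^ q) := by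
            gcongr
        _ = _ := by field_simp
  rw [le_div_iff₀ (by positivity)] at this
  linarith

end st

section st2
variable {d : ℕ}
local notation "E" => EuclideanSpace ℝ (Fin d)

theorem timeD_smooth (u : E × ℝ → ℝ) (hu : ContDiff ℝ ∞ u) (q : ℕ) :
    ContDiff ℝ ∞ (fun z : E × ℝ => iteratedDeriv q (fun τ => u (z.1, τ)) z.2) := by
  have h1 : (fun z : E × ℝ => iteratedDeriv q (fun τ => u (z.1, τ)) z.2) =
      dd (List.replicate q ((0 : E), (1:ℝ))) u := by
    funext z
    have := dd_time u hu 1 q z.1 z.2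
    simpa using this.symm
  rw [h1]
  exact dd_smooth _ u hu

theorem top_est (u : E × ℝ → ℝ) (hu : ContDiff ℝ ∞ u) (p q L : ℕ) (hL : p + 2 * q = L) (hL1 : 1 ≤ L)
    (α : ℝ) (hα0 : 0 < α) (hα1 : α < 1) (ρ R t r A B : ℝ) (hr : 0 < r) (hB : 0 ≤ B)
    (hA : ∀ z ∈ parabolicCylinder d ρ t, |u z| ≤ A)
    (hH : ∀ z ∈ parabolicCylinder d ρ t, ∀ w ∈ parabolicCylinder d ρ t,
      ‖spaceTimeDeriv d u p q z.1 z.2 - spaceTimeDeriv d u p q w.1 w.2‖ ≤ B * parabolicDist d z w ^ α)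
    (hR : R + L * r ≤ ρ) (hLr : L * r ^ 2 ≤ 1 / 2) (hBA : B * (r ^ L * r ^ α) ≤ A)
    (z : E × ℝ) (hz : z ∈ parabolicCylinder d R t) :
    r ^ L * ‖spaceTimeDeriv d u p q z.1 z.2‖ ≤ (2 ^ L + L) * A := by
  obtain ⟨x, s⟩ := z
  obtain ⟨hx, hs1, hs2⟩ := hz
  simp only at hx hs1 hs2 ⊢
  have hpL : (p : ℝ) ≤ L := by exact_mod_cast (by omega : p ≤ L)
  have hqL : (q : ℝ) ≤ L := by exact_mod_cast (by omega : q ≤ L)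
  have hpqL : (p : ℝ) + q ≤ L := by exact_mod_cast (by omega : p + q ≤ L)
  have hL1' : (1 : ℝ) ≤ L := by exact_mod_cast hL1
  have hA0 : 0 ≤ A := le_trans (by positivity) hBA
  obtain ⟨c, hcabs, hc⟩ : ∃ c : ℝ, |c| = r ^ 2 ∧ ∀ τ : ℝ, 0 ≤ τ → τ ≤ q →
      t - 1 ≤ s + τ * c ∧ s + τ * c ≤ t := by
    have hb : ∀ τ : ℝ, 0 ≤ τ → τ ≤ q → 0 ≤ τ * r ^ 2 ∧ τ * r ^ 2 ≤ 1 / 2 := by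
      intro τ h0 h1
      refine ⟨by positivity, le_trans ?_ hLr⟩
      have : τ ≤ L := h1.trans hqL
      gcongr
    by_cases h : s ≤ t - 1 / 2
    · refine ⟨r ^ 2, abs_of_pos (by positivity), fun τ h0 h1 => ?_⟩
      have := hb τ h0 h1
      constructor <;> linarith
    · refine ⟨- r ^ 2, by rw [abs_neg, abs_of_pos (by positivity)], fun τ h0 h1 => ?_⟩
      have := hb τ h0 h1
      push Not at h
      constructor <;> linarith
  have hc0 : c ≠ 0 := by
    rintro rfl
    rw [abs_zero] at hcabs
    exact absurd hcabs.symm (by positivity)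
  have hQ : ∀ y : E, ∀ τ : ℝ, ‖y - x‖ ≤ p * r → 0 ≤ τ → τ ≤ q →
      (y, s + τ * c) ∈ parabolicCylinder d ρ t := by
    intro y τ h1 h2 h3
    refine ⟨?_, hc τ h2 h3⟩
    have h4 : ‖y‖ ≤ ‖y - x‖ + ‖x‖ := by simpa using norm_add_le (y - x) x
    have h5 : (p : ℝ) * r ≤ L * r := by gcongr
    simp only
    linarith
  have hxs : (x, s) ∈ parabolicCylinder d ρ t := by
    have := hQ x 0 (by simp; positivity) le_rfl (by positivity)
    simpa using this
  have hk := key_est u hu p q x s r c A (B * (L * r) ^ α) hr (by positivity) hc0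
    (fun y τ h1 h2 h3 => hA _ (hQ y τ h1 h2 h3))
    (by
      intro y τ h1 h2 h3
      refine (hH _ (hQ y τ h1 h2 h3) _ hxs).trans ?_
      have hd0 : 0 ≤ parabolicDist d (y, s + τ * c) (x, s) := by
        unfold parabolicDist; positivity
      have hd : parabolicDist d (y, s + τ * c) (x, s) ≤ L * r := by
        unfold parabolicDist
        simp only [add_sub_cancel_left]
        rw [← Real.sqrt_eq_rpow, abs_mul, hcabs, abs_of_nonneg h2]
        have : √(τ * r ^ 2) ≤ q * r := by
          apply Real.sqrt_le_iff.2 ⟨by positivity, ?_⟩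
          rw [mul_pow]
          have : τ ≤ (q : ℝ) ^ 2 := h3.trans (by
            have : q ≤ q ^ 2 := Nat.le_self_pow (by norm_num) q
            exact_mod_cast this)
          gcongr
        have : ((p : ℝ) + q) * r ≤ L * r := by gcongr
        linarith
      gcongr)
  have e1 : r ^ p * |c| ^ q = r ^ L := by
    rw [hcabs, ← pow_mul, ← pow_add, hL]
  rw [e1] at hk
  have e2 : ((L : ℝ) * r) ^ α ≤ L * r ^ α := by
    rw [Real.mul_rpow (by positivity) hr.le]
    have : (L : ℝ) ^ α ≤ (L : ℝ) ^ (1 : ℝ) := Real.rpow_le_rpow_of_exponent_le hL1' hα1.le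
    rw [Real.rpow_one] at this
    gcongr
  have e3 : (2 : ℝ) ^ (p + q) * A ≤ 2 ^ L * A := by
    have : (2 : ℝ) ^ (p + q) ≤ 2 ^ L := pow_le_pow_right₀ (by norm_num) (by omega)
    gcongr
  have e4 : r ^ L * (B * (↑L * r) ^ α) ≤ L * A := by
    calc r ^ L * (B * (↑L * r) ^ α) ≤ r ^ L * (B * (↑L * r ^ α)) := by gcongr
      _ = L * (B * (r ^ L * r ^ α)) := by ring
      _ ≤ _ := by gcongr
  linarith

/-- Purely spatial step. -/
theorem space_est (f : E → ℝ) (hf : ContDiff ℝ ∞ f) (p : ℕ) (x : E) (r A K : ℝ) (hr : 0 < r)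
    (hA : ∀ y, ‖y - x‖ ≤ p * r → |f y| ≤ A)
    (hK : ∀ y, ‖y - x‖ ≤ p * r → ‖iteratedFDeriv ℝ (p + 1) f y‖ ≤ K) :
    r ^ p * ‖iteratedFDeriv ℝ p f x‖ ≤ 2 ^ p * A + r ^ p * (K * (p * r)) := by
  have hK0 : 0 ≤ K := (norm_nonneg _).trans (hK x (by simp; positivity))
  have hst : ∀ y s, spaceTimeDeriv d (fun z => f z.1) p 0 y s = iteratedFDeriv ℝ p f y := by
    intro y s; simp [spaceTimeDeriv]
  have hk := key_est (fun z : E × ℝ => f z.1) (hf.comp contDiff_fst) p 0 x 0 r 1 A (K * (p * r)) hr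
    (by positivity) one_ne_zero (fun y τ h1 _ _ => hA y h1)
    (by
      intro y τ h1 _ _
      rw [hst, hst]
      have hconv : Convex ℝ (Metric.closedBall x (p * r)) := convex_closedBall _ _
      have := hconv.norm_image_sub_le_of_norm_fderiv_le (𝕜 := ℝ) (f := iteratedFDeriv ℝ p f) (C := K)
        (x := x) (y := y)
        (fun w _ => (hf.differentiable_iteratedFDeriv (by exact_mod_cast WithTop.coe_lt_top _)) w)
        (fun w hw => by
          rw [norm_fderiv_iteratedFDeriv]
          exact hK w (by simpa [dist_eq_norm] using hw))
        (Metric.mem_closedBall_self (by positivity)) (by simpa [dist_eq_norm] using h1)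
      exact this.trans (by gcongr))
  rw [hst] at hk
  simpa using hk

end st2

section st3
variable {d : ℕ}
local notation "E" => EuclideanSpace ℝ (Fin d)

theorem norm_std_zero (u : E × ℝ → ℝ) (q : ℕ) (x : E) (s : ℝ) :
    ‖spaceTimeDeriv d u 0 q x s‖ = |iteratedDeriv q (fun τ => u (x, τ)) s| := by
  unfold spaceTimeDeriv
  rw [norm_iteratedFDeriv_zero, Real.norm_eq_abs]

theorem norm_std_zero_sub (u : E × ℝ → ℝ) (q : ℕ) (x : E) (s s' : ℝ) :
    ‖spaceTimeDeriv d u 0 q x s - spaceTimeDeriv d u 0 q x s'‖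
      = |iteratedDeriv q (fun τ => u (x, τ)) s - iteratedDeriv q (fun τ => u (x, τ)) s'| := by
  unfold spaceTimeDeriv
  rw [iteratedFDeriv_zero_eq_comp, iteratedFDeriv_zero_eq_comp]
  simp only [Function.comp_apply]
  rw [← map_sub, LinearIsometryEquiv.norm_map, Real.norm_eq_abs]

theorem time_est (u : E × ℝ → ℝ) (hu : ContDiff ℝ ∞ u) (R t r A K : ℝ) (hr : 0 < r)
    (hr2 : r ^ 2 ≤ 1 / 2)
    (hA : ∀ z ∈ parabolicCylinder d R t, |u z| ≤ A)
    (hK : ∀ z ∈ parabolicCylinder d R t, ‖spaceTimeDeriv d u 0 2 z.1 z.2‖ ≤ K)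
    (z : E × ℝ) (hz : z ∈ parabolicCylinder d R t) :
    r ^ 2 * ‖spaceTimeDeriv d u 0 1 z.1 z.2‖ ≤ 2 * A + r ^ 2 * (K * r ^ 2) := by
  have hK0 : 0 ≤ K := (norm_nonneg _).trans (hK z hz)
  obtain ⟨x, s⟩ := z
  obtain ⟨hx, hs1, hs2⟩ := hz
  simp only at hx hs1 hs2 ⊢
  obtain ⟨c, hcabs, hc⟩ : ∃ c : ℝ, |c| = r ^ 2 ∧ ∀ τ : ℝ, 0 ≤ τ → τ ≤ 1 →
      t - 1 ≤ s + τ * c ∧ s + τ * c ≤ t := by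
    have hb : ∀ τ : ℝ, 0 ≤ τ → τ ≤ 1 → 0 ≤ τ * r ^ 2 ∧ τ * r ^ 2 ≤ 1 / 2 := by
      intro τ h0 h1
      refine ⟨by positivity, le_trans ?_ hr2⟩
      exact mul_le_of_le_one_left (by positivity) h1
    by_cases h : s ≤ t - 1 / 2
    · refine ⟨r ^ 2, abs_of_pos (by positivity), fun τ h0 h1 => ?_⟩
      have := hb τ h0 h1
      constructor <;> linarith
    · refine ⟨- r ^ 2, by rw [abs_neg, abs_of_pos (by positivity)], fun τ h0 h1 => ?_⟩
      have := hb τ h0 h1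
      push Not at h
      constructor <;> linarith
  have hc0 : c ≠ 0 := by
    rintro rfl
    rw [abs_zero] at hcabs
    exact absurd hcabs.symm (by positivity)
  have hk := key_est u hu 0 1 x s r c A (K * r ^ 2) hr (by positivity) hc0
    (by
      intro y τ h1 h2 h3
      have hy : y = x := by simpa [sub_eq_zero] using h1
      subst hy
      exact hA _ ⟨hx, hc τ h2 (by simpa using h3)⟩)
    (by
      intro y τ h1 h2 h3
      have hy : y = x := by simpa [sub_eq_zero] using h1
      subst hy
      have h3' : τ ≤ 1 := by simpa using h3
      rw [norm_std_zero_sub]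
      have hf : ContDiff ℝ ∞ (fun τ => u (y, τ)) := hu.comp (contDiff_const.prodMk contDiff_id)
      have hconv : Convex ℝ (Set.Icc (t - 1) t) := convex_Icc _ _
      have hm := hconv.norm_image_sub_le_of_norm_deriv_le (𝕜 := ℝ)
        (f := iteratedDeriv 1 (fun τ => u (y, τ))) (C := K) (x := s) (y := s + τ * c)
        (fun w _ => (hf.differentiable_iteratedDeriv 1 (by exact_mod_cast WithTop.coe_lt_top _)) w)
        (fun w hw => by
          rw [← iteratedDeriv_succ, Real.norm_eq_abs, ← norm_std_zero]
          exact hK (y, w) ⟨hx, hw⟩)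
        ⟨hs1, hs2⟩ (hc τ h2 h3')
      rw [Real.norm_eq_abs] at hm
      refine hm.trans ?_
      rw [add_sub_cancel_left, norm_mul, Real.norm_eq_abs c, hcabs, Real.norm_of_nonneg h2]
      have : τ * r ^ 2 ≤ r ^ 2 := mul_le_of_le_one_left (by positivity) h3'
      gcongr)
  rw [hcabs] at hk
  simpa using hk

theorem lower_est (u : E × ℝ → ℝ) (hu : ContDiff ℝ ∞ u) (ρ t r A : ℝ) (hr : 0 < r)
    (hr2 : r ^ 2 ≤ 1 / 2) (hA0 : 0 ≤ A)
    (hA : ∀ z ∈ parabolicCylinder d ρ t, |u z| ≤ A)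
    (h4 : ∀ p q : ℕ, p + 2 * q = 4 → ∀ z ∈ parabolicCylinder d (ρ - 4 * r) t,
      r ^ 4 * ‖spaceTimeDeriv d u p q z.1 z.2‖ ≤ 20 * A)
    (p q : ℕ) (hpq : p + 2 * q ≤ 4) (z : E × ℝ) (hz : z ∈ parabolicCylinder d (ρ - 10 * r) t) :
    r ^ (p + 2 * q) * ‖spaceTimeDeriv d u p q z.1 z.2‖ ≤ 142 * A := by
  have hmono : ∀ a b : ℝ, a ≤ b → ∀ z ∈ parabolicCylinder d a t, z ∈ parabolicCylinder d b t :=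
    fun a b hab z hz => ⟨hz.1.trans hab, hz.2⟩
  have hstep : ∀ (a b : ℝ) (z : E × ℝ) (y : E), z ∈ parabolicCylinder d a t → ‖y - z.1‖ ≤ b - a →
      (y, z.2) ∈ parabolicCylinder d b t := by
    intro a b z y hz hy
    refine ⟨?_, hz.2⟩
    have h1 : ‖y‖ ≤ ‖y - z.1‖ + ‖z.1‖ := by simpa using norm_add_le (y - z.1) z.1
    have := hz.1
    simp only
    linarith
  have hdiv : ∀ (n : ℕ) (x K : ℝ), r ^ n * x ≤ K → x ≤ K / r ^ n := by
    intro n x K h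
    rw [le_div_iff₀ (by positivity)]; linarith
  have hu0 : ∀ s : ℝ, ContDiff ℝ ∞ (fun y : E => u (y, s)) :=
    fun s => hu.comp (contDiff_id.prodMk contDiff_const)
  have hs0 : ∀ (p : ℕ) (x : E) (s : ℝ), spaceTimeDeriv d u p 0 x s =
      iteratedFDeriv ℝ p (fun y => u (y, s)) x := by
    intro p x s; simp [spaceTimeDeriv]
  have e3 : ∀ z ∈ parabolicCylinder d (ρ - 7 * r) t,
      r ^ 3 * ‖spaceTimeDeriv d u 3 0 z.1 z.2‖ ≤ 68 * A := by
    intro z hz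
    have := space_est (fun y => u (y, z.2)) (hu0 z.2) 3 z.1 r A (20 * A / r ^ 4) hr
      (fun y hy => hA _ (hstep (ρ - 7 * r) _ z y hz (by push_cast at hy; linarith)))
      (fun y hy => by
        have := h4 4 0 rfl (y, z.2) (hstep (ρ - 7 * r) _ z y hz (by push_cast at hy; linarith))
        rw [hs0] at this
        exact hdiv _ _ _ this)
    rw [hs0]
    refine this.trans (le_of_eq ?_)
    push_cast
    field_simp
    ring
  have e2 : ∀ z ∈ parabolicCylinder d (ρ - 9 * r) t,
      r ^ 2 * ‖spaceTimeDeriv d u 2 0 z.1 z.2‖ ≤ 140 * A := by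
    intro z hz
    have := space_est (fun y => u (y, z.2)) (hu0 z.2) 2 z.1 r A (68 * A / r ^ 3) hr
      (fun y hy => hA _ (hstep (ρ - 9 * r) _ z y hz (by push_cast at hy; linarith)))
      (fun y hy => by
        have := e3 (y, z.2) (hstep (ρ - 9 * r) _ z y hz (by push_cast at hy; linarith))
        rw [hs0] at this
        exact hdiv _ _ _ this)
    rw [hs0]
    refine this.trans (le_of_eq ?_)
    push_cast
    field_simp
    ring
  have e1 : ∀ z ∈ parabolicCylinder d (ρ - 10 * r) t,
      r ^ 1 * ‖spaceTimeDeriv d u 1 0 z.1 z.2‖ ≤ 142 * A := by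
    intro z hz
    have := space_est (fun y => u (y, z.2)) (hu0 z.2) 1 z.1 r A (140 * A / r ^ 2) hr
      (fun y hy => hA _ (hstep (ρ - 10 * r) _ z y hz (by push_cast at hy; linarith)))
      (fun y hy => by
        have := e2 (y, z.2) (hstep (ρ - 10 * r) _ z y hz (by push_cast at hy; linarith))
        rw [hs0] at this
        exact hdiv _ _ _ this)
    rw [hs0]
    refine this.trans (le_of_eq ?_)
    push_cast
    field_simp
    ring
  have f1 : ∀ z ∈ parabolicCylinder d (ρ - 4 * r) t,
      r ^ 2 * ‖spaceTimeDeriv d u 0 1 z.1 z.2‖ ≤ 22 * A := by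
    intro z hz
    have := time_est u hu (ρ - 4 * r) t r A (20 * A / r ^ 4) hr hr2
      (fun z hz => hA z (hmono _ _ (by linarith) z hz))
      (fun z hz => hdiv _ _ _ (h4 0 2 rfl z hz)) z hz
    refine this.trans (le_of_eq ?_)
    field_simp
    ring
  have g1 : ∀ z ∈ parabolicCylinder d (ρ - 5 * r) t,
      r ^ 3 * ‖spaceTimeDeriv d u 1 1 z.1 z.2‖ ≤ 64 * A := by
    intro z hz
    have hU : ContDiff ℝ ∞ (fun y : E => iteratedDeriv 1 (fun τ => u (y, τ)) z.2) :=
      (timeD_smooth u hu 1).comp (contDiff_id.prodMk contDiff_const)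
    have := space_est (fun y => iteratedDeriv 1 (fun τ => u (y, τ)) z.2) hU 1 z.1 r
      (22 * A / r ^ 2) (20 * A / r ^ 4) hr
      (fun y hy => by
        have := f1 (y, z.2) (hstep (ρ - 5 * r) _ z y hz (by push_cast at hy; linarith))
        rw [norm_std_zero] at this
        exact hdiv _ _ _ this)
      (fun y hy => by
        have := h4 2 1 rfl (y, z.2) (hstep (ρ - 5 * r) _ z y hz (by push_cast at hy; linarith))
        exact hdiv _ _ _ this)
    have h5 := mul_le_mul_of_nonneg_left this (sq_nonneg r)
    have h6 : r ^ 3 * ‖spaceTimeDeriv d u 1 1 z.1 z.2‖ = r ^ 2 * (r ^ 1 * 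
      ‖iteratedFDeriv ℝ 1 (fun y => iteratedDeriv 1 (fun τ => u (y, τ)) z.2) z.1‖) := by
      unfold spaceTimeDeriv; ring
    rw [h6]
    refine h5.trans (le_of_eq ?_)
    push_cast
    field_simp
    ring
  have hp : p ≤ 4 := by omega
  have hq : q ≤ 2 := by omega
  have hz4 := hmono _ (ρ - 4 * r) (by linarith) z hz
  by_cases h : p + 2 * q = 4
  · rw [h]
    exact (h4 p q h z hz4).trans (by linarith)
  interval_cases q <;> interval_cases p <;> first | omega | skip
  · have := hA z (hmono _ _ (by linarith) z hz)
    rw [norm_std_zero]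
    simp only [iteratedDeriv_zero, Prod.mk.eta]
    simpa using this.trans (by linarith)
  · exact e1 z hz
  · exact (e2 z (hmono _ _ (by linarith) z hz)).trans (by linarith)
  · exact (e3 z (hmono _ _ (by linarith) z hz)).trans (by linarith)
  · exact (f1 z hz4).trans (by linarith)
  · exact (g1 z (hmono _ _ (by linarith) z hz)).trans (by linarith)

theorem frakD_le (u : E × ℝ → ℝ) (l : ℕ) (z : E × ℝ) (K : ℝ) (hK : 0 ≤ K)
    (h : ∀ p q : ℕ, p + 2 * q = l → ‖spaceTimeDeriv d u p q z.1 z.2‖ ≤ K) :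
    frakDNorm d u l z ≤ (l + 1) * K := by
  unfold frakDNorm
  apply Real.sqrt_le_iff.2 ⟨by positivity, ?_⟩
  have hq : ∀ q ∈ Finset.range (l / 2 + 1), ‖spaceTimeDeriv d u (l - 2 * q) q z.1 z.2‖ ^ 2 ≤ K ^ 2 := by
    intro q hq
    rw [Finset.mem_range] at hq
    have := h (l - 2 * q) q (by omega)
    gcongr
  refine (Finset.sum_le_sum hq).trans ?_
  rw [Finset.sum_const, Finset.card_range, nsmul_eq_mul, mul_pow]
  have h1 : ((l / 2 + 1 : ℕ) : ℝ) ≤ (l + 1 : ℝ) := by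
    have : l / 2 + 1 ≤ l + 1 := by omega
    exact_mod_cast this
  have h2 : (l + 1 : ℝ) ≤ (l + 1 : ℝ) ^ 2 := by
    have : (0:ℝ) ≤ l := by positivity
    nlinarith
  have := h1.trans h2
  gcongr

theorem holder_comp (u : E × ℝ → ℝ) (α : ℝ) (l : ℕ) (Q : Set (E × ℝ)) (B : ℝ)
    (h : frakDHolderLE d u l α Q B) (p q : ℕ) (hpq : p + 2 * q = l) :
    ∀ z ∈ Q, ∀ w ∈ Q, ‖spaceTimeDeriv d u p q z.1 z.2 - spaceTimeDeriv d u p q w.1 w.2‖ ≤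
      B * parabolicDist d z w ^ α := by
  obtain ⟨M, hM, hs, hb⟩ := h
  intro z hz w hw
  have hq : q ∈ Finset.range (l / 2 + 1) := by rw [Finset.mem_range]; omega
  have hp : p = l - 2 * q := by omega
  subst hp
  refine (hb q hq z hz w hw).trans ?_
  have h1 : M q ≤ B := (Finset.single_le_sum (fun i _ => hM i) hq).trans hs
  have h2 : 0 ≤ parabolicDist d z w := by unfold parabolicDist; positivity
  gcongr

end st3

/-- Choice of scale: `r = c exp(-(L-2)t/(2(L+α)))`. -/
theorem scale_choice (L : ℕ) (hL : 4 ≤ L) (α : ℝ) (hα0 : 0 < α) (t : ℝ) (ht : 1 ≤ t) (c C₀ : ℝ)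
    (hc : 0 < c) (hc1 : c ≤ 1) (hC₀ : 0 < C₀) :
    ∃ r : ℝ, 0 < r ∧ r ≤ c ∧
      C₀ * Real.exp (((L : ℝ) - 6) * t / 2) * (r ^ L * r ^ α) ≤ C₀ * Real.exp (-2 * t) ∧
      ∀ l : ℕ, C₀ * Real.exp (-2 * t) / r ^ l =
        C₀ * (c⁻¹) ^ l * Real.exp (-(t / 2) * (4 - (l : ℝ) * ((L : ℝ) - 2) / ((L : ℝ) + α))) := by
  have hL' : (4 : ℝ) ≤ L := by exact_mod_cast hL
  have hLα : 0 < (L : ℝ) + α := by linarith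
  set θ : ℝ := ((L : ℝ) - 2) * t / (2 * (L + α)) with hθ
  have hθ0 : 0 ≤ θ := by
    rw [hθ]
    apply div_nonneg (mul_nonneg (by linarith) (by linarith)) (by linarith)
  have hr0 : 0 < c * Real.exp (-θ) := by positivity
  refine ⟨c * Real.exp (-θ), hr0, ?_, ?_, ?_⟩
  · exact mul_le_of_le_one_right hc.le (Real.exp_le_one_iff.2 (by linarith))
  · rw [← Real.rpow_natCast, ← Real.rpow_add hr0, Real.mul_rpow hc.le (Real.exp_pos _).le,
      ← Real.exp_mul]
    have h1 : c ^ ((L : ℝ) + α) ≤ 1 := Real.rpow_le_one hc.le hc1 hLα.le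
    have h2 : Real.exp (((L : ℝ) - 6) * t / 2) * Real.exp (-θ * (L + α)) = Real.exp (-2 * t) := by
      rw [← Real.exp_add]
      congr 1
      rw [hθ]
      field_simp
      ring
    calc _ = C₀ * (Real.exp (((L : ℝ) - 6) * t / 2) * Real.exp (-θ * (L + α))) * c ^ ((L : ℝ) + α) := by ring
      _ ≤ _ := by
        rw [h2]
        exact mul_le_of_le_one_right (by positivity) h1
  · intro l
    rw [mul_pow, ← Real.exp_nat_mul, div_eq_mul_inv, mul_inv, ← Real.exp_neg, inv_pow]
    have : Real.exp (-2 * t) * Real.exp (-(↑l * -θ)) =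
        Real.exp (-(t / 2) * (4 - (l : ℝ) * ((L : ℝ) - 2) / ((L : ℝ) + α))) := by
      rw [← Real.exp_add]
      congr 1
      rw [hθ]
      field_simp
      ring
    rw [← this]
    ring

/-- Interpolation estimates for the first-order expansion coefficients
(Lemma 3.2 of the paper, in conditional form). -/
theorem interp_first_order_coefficients
    (d : ℕ) (hd : 1 ≤ d) (ρ ρ' : ℝ) (hρ' : 0 < ρ') (hρ : ρ' < ρ)
    (α : ℝ) (hα0 : 0 < α) (hα1 : α < 1) (k : ℕ) (hk : 4 ≤ k) (C₀ : ℝ) (hC₀ : 0 < C₀)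
    (u : EuclideanSpace ℝ (Fin d) × ℝ → ℝ) (hu : ContDiff ℝ (⊤ : ℕ∞) u)
    (h1 : ∀ t ≥ (1 : ℝ), ∀ z ∈ parabolicCylinder d ρ t, |u z| ≤ C₀ * Real.exp (-2 * t))
    (h2 : ∀ t ≥ (1 : ℝ), frakDHolderLE d u 4 α (parabolicCylinder d ρ t) (C₀ * Real.exp (-t)))
    (h3 : ∀ t ≥ (1 : ℝ), ∀ ℓ : ℕ, 4 ≤ ℓ → ℓ ≤ 2 * k + 6 →
      frakDHolderLE d u ℓ α (parabolicCylinder d ρ t)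
        (C₀ * Real.exp (((ℓ : ℝ) - 6) * t / 2))) :
    ∃ C > 0, ∀ t ≥ (1 : ℝ),
      (∀ ℓ : ℕ, ℓ ≤ 4 → ∀ z ∈ parabolicCylinder d ρ' t,
        frakDNorm d u ℓ z ≤ C * Real.exp (-(t / 2) * (4 - 2 * (ℓ : ℝ) / (4 + α)))) ∧
      (∀ ℓ : ℕ, 4 ≤ ℓ → ℓ ≤ 2 * k + 6 → ∀ z ∈ parabolicCylinder d ρ' t,
        frakDNorm d u ℓ z ≤
          C * Real.exp (-(t / 2) * (4 - (ℓ : ℝ) * ((ℓ : ℝ) - 2) / ((ℓ : ℝ) + α)))) := by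
  set N : ℕ := 2 * k + 6 with hN
  have hNr : (14 : ℝ) ≤ N := by exact_mod_cast (by omega : 14 ≤ N)
  set c : ℝ := min 1 (ρ - ρ') / (2 * N) with hc
  have hm : 0 < min 1 (ρ - ρ') := lt_min one_pos (by linarith)
  have hc0 : 0 < c := by positivity
  have hcN : N * c * 2 = min 1 (ρ - ρ') := by rw [hc]; field_simp
  have hcN1 : N * c * 2 ≤ 1 := hcN ▸ min_le_left _ _
  have hcN2 : N * c * 2 ≤ ρ - ρ' := hcN ▸ min_le_right _ _
  have hc1 : c ≤ 1 := by nlinarith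
  have hci : 1 ≤ c⁻¹ := (one_le_inv₀ hc0).2 hc1
  have hrr : ∀ r : ℝ, 0 < r → r ≤ c → N * r ^ 2 ≤ 1 / 2 ∧ N * r ≤ ρ - ρ' := by
    intro r h0 h1
    have h2 : N * r ≤ N * c := by gcongr
    have h3 : r ≤ 1 := h1.trans hc1
    have h4 : N * r ^ 2 ≤ N * r := by
      have : r ^ 2 ≤ r := by nlinarith
      gcongr
    constructor <;> linarith
  set P : ℝ := 2 ^ N + N + 142 with hP
  have hP0 : 0 < P := by positivity
  -- top-order components
  have top : ∀ t ≥ (1 : ℝ), ∀ L : ℕ, 4 ≤ L → L ≤ N → ∀ r : ℝ, 0 < r → r ≤ c →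
      C₀ * Real.exp (((L : ℝ) - 6) * t / 2) * (r ^ L * r ^ α) ≤ C₀ * Real.exp (-2 * t) →
      ∀ p q : ℕ, p + 2 * q = L → ∀ R, R + L * r ≤ ρ → ∀ z ∈ parabolicCylinder d R t,
      r ^ L * ‖spaceTimeDeriv d u p q z.1 z.2‖ ≤ (2 ^ L + L) * (C₀ * Real.exp (-2 * t)) := by
    intro t ht L hL4 hLN r hr0 hrc hBA p q hpq R hR z hz
    have hLN' : (L : ℝ) ≤ N := by exact_mod_cast hLN
    refine top_est u hu p q L hpq (by omega) α hα0 hα1 ρ R t r _ _ hr0 (by positivity)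
      (h1 t ht) (holder_comp u α L _ _ (h3 t ht L hL4 hLN) p q hpq) hR ?_ hBA z hz
    refine le_trans ?_ (hrr r hr0 hrc).1
    gcongr
  have fin : ∀ (t r : ℝ) (l L : ℕ), l ≤ N → 0 < r →
      C₀ * Real.exp (-2 * t) / r ^ l =
        C₀ * (c⁻¹) ^ l * Real.exp (-(t / 2) * (4 - (l : ℝ) * ((L : ℝ) - 2) / ((L : ℝ) + α))) →
      ∀ z : EuclideanSpace ℝ (Fin d) × ℝ, (∀ p q : ℕ, p + 2 * q = l →
        r ^ l * ‖spaceTimeDeriv d u p q z.1 z.2‖ ≤ P * (C₀ * Real.exp (-2 * t))) →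
      frakDNorm d u l z ≤ (N + 1) * P * C₀ * (c⁻¹) ^ N *
        Real.exp (-(t / 2) * (4 - (l : ℝ) * ((L : ℝ) - 2) / ((L : ℝ) + α))) := by
    intro t r l L hl hr0 he z hz
    have hl' : (l : ℝ) ≤ N := by exact_mod_cast hl
    have hpw : (c⁻¹) ^ l ≤ (c⁻¹) ^ N := pow_le_pow_right₀ hci hl
    refine (frakD_le u l z (P * (C₀ * Real.exp (-2 * t) / r ^ l)) (by positivity) ?_).trans ?_
    · intro p q hpq
      rw [← mul_div_assoc, le_div_iff₀ (by positivity), mul_comm]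
      exact hz p q hpq
    · rw [he]
      calc _ ≤ (N + 1) * (P * (C₀ * (c⁻¹) ^ N *
            Real.exp (-(t / 2) * (4 - (l : ℝ) * ((L : ℝ) - 2) / ((L : ℝ) + α))))) := by gcongr
        _ = _ := by ring
  refine ⟨(N + 1) * P * C₀ * (c⁻¹) ^ N, by positivity, ?_⟩
  intro t ht
  constructor
  · intro l hl z hz
    obtain ⟨r, hr0, hrc, hBA, he⟩ := scale_choice 4 le_rfl α hα0 t ht c C₀ hc0 hc1 hC₀
    obtain ⟨hb1, hb2⟩ := hrr r hr0 hrc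
    have := fin t r l 4 (by omega) hr0 (he l) z (by
      rintro p q rfl
      have := lower_est u hu ρ t r (C₀ * Real.exp (-2 * t)) hr0
        (by nlinarith [sq_nonneg r]) (by positivity) (h1 t ht)
        (fun p q hpq z hz => by
          have := top t ht 4 le_rfl (by omega) r hr0 hrc hBA p q hpq (ρ - 4 * r)
            (by push_cast; linarith) z hz
          norm_num at this ⊢
          exact this)
        p q hl z ⟨hz.1.trans (by nlinarith), hz.2⟩
      refine this.trans ?_
      have h142 : (142 : ℝ) ≤ P := by
        have : (0 : ℝ) < 2 ^ N := by positivity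
        linarith
      gcongr)
    have e : 2 * (l : ℝ) / (4 + α) = (l : ℝ) * (((4 : ℕ) : ℝ) - 2) / (((4 : ℕ) : ℝ) + α) := by
      push_cast; ring
    rw [e]
    exact this
  · intro l hl4 hlN z hz
    obtain ⟨r, hr0, hrc, hBA, he⟩ := scale_choice l hl4 α hα0 t ht c C₀ hc0 hc1 hC₀
    obtain ⟨hb1, hb2⟩ := hrr r hr0 hrc
    have hl' : (l : ℝ) ≤ N := by exact_mod_cast hlN
    refine fin t r l l hlN hr0 (he l) z ?_
    intro p q hpq
    have h5 : (l : ℝ) * r ≤ N * r := by gcongr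
    refine (top t ht l hl4 hlN r hr0 hrc hBA p q hpq ρ' (by linarith) z hz).trans ?_
    have h6 : (2 : ℝ) ^ l ≤ 2 ^ N := pow_le_pow_right₀ (by norm_num) hlN
    have h7 : (2 : ℝ) ^ l + l ≤ P := by linarith
    gcongr
end

section
/- Interpolation estimates for the second-order expansion coefficients (Lemma 3.3 of the paper, in conditional form): Let α ∈ (0,1), let k ≥ 4 be an integer, and let C₀ > 0. Suppose u : ℝ^d × ℝ → ℝ is smooth and for every t ≥ 1 satisfies (i) sup_{Q_ρ(t)} |u| ≤ C₀ e^{−(4+α)t/2}, (ii) [𝔇⁴u]_{α,Q_ρ(t)} ≤ C₀ e^{−t}, and (iii) [𝔇^ℓ u]_{α,Q_ρ(t)} ≤ C₀ e^{(ℓ−6)t/2} for every integer 4 ≤ ℓ ≤ 2k+6. Then there exists C > 0 such that for every t ≥ 1: sup_{Q_{ρ′}(t)} |𝔇^ℓ u| ≤ C e^{−(t/2)(4 + α − (2+α)ℓ/(4+α))} for every integer 0 ≤ ℓ ≤ 4, and sup_{Q_{ρ′}(t)} |𝔇^ℓ u| ≤ C e^{−(t/2)(4 + (ℓ(2−ℓ)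 + α²)/(ℓ+α))} for every integer 4 ≤ ℓ ≤ 2k+6. -/
open Real Finset

open scoped ContDiff

theorem aux_mv {E F : Type*} [NormedAddCommGroup E] [NormedSpace ℝ E]
    [NormedAddCommGroup F] [NormedSpace ℝ F] (G : E → F) (hG : Differentiable ℝ G)
    (c : E) (R : ℝ) (L : E →L[ℝ] F) (ε : ℝ)
    (hL : ∀ y ∈ Metric.closedBall c R, ‖fderiv ℝ G y - L‖ ≤ ε)
    (a b : E) (ha : a ∈ Metric.closedBall c R) (hb : b ∈ Metric.closedBall c R) :
    ‖G b - G a - L (b - a)‖ ≤ ε * ‖b - a‖ :=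
  (convex_closedBall c R).norm_image_sub_le_of_norm_fderiv_le' (fun y _ => hG y) hL ha hb

theorem aux_fd_space {E F : Type*} [NormedAddCommGroup E] [NormedSpace ℝ E]
    [NormedAddCommGroup F] [NormedSpace ℝ F] (h : ℝ) (hh : 0 < h) (p : ℕ) :
    ∀ (G : E → F) (_ : ContDiff ℝ ∞ G) (x : E) (A ε : ℝ) (_ : 0 ≤ A) (_ : 0 ≤ ε)
      (T : ContinuousMultilinearMap ℝ (fun _ : Fin p => E) F)
      (_ : ∀ y ∈ Metric.closedBall x (p * h), ‖G y‖ ≤ A)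
      (_ : ∀ y ∈ Metric.closedBall x (p * h), ‖iteratedFDeriv ℝ p G y - T‖ ≤ ε),
      ‖T‖ ≤ 2 ^ p * A / h ^ p + ε := by
  induction p with
  | zero =>
    intro G hG x A ε hA hε T h1 h2
    have a1 := h1 x (by simp)
    have a2 := h2 x (by simp)
    have : ‖T‖ ≤ ‖iteratedFDeriv ℝ 0 G x‖ + ‖iteratedFDeriv ℝ 0 G x - T‖ := by
      have := norm_sub_le (iteratedFDeriv ℝ 0 G x) (iteratedFDeriv ℝ 0 G x - T)
      simpa using this
    rw [norm_iteratedFDeriv_zero] at this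
    simp; linarith
  | succ n ih =>
    intro G hG x A ε hA hε T h1 h2
    have key : ∀ e : E, ‖e‖ = 1 → ‖T.curryLeft e‖ ≤ 2 ^ (n+1) * A / h ^ (n+1) + ε := by
      intro e he
      have hsub : ∀ y ∈ Metric.closedBall x (n * h),
          y ∈ Metric.closedBall x ((n+1 : ℕ) * h) ∧ y + h • e ∈ Metric.closedBall x ((n+1 : ℕ) * h) := by
        intro y hy
        rw [mem_closedBall_iff_norm] at hy
        rw [mem_closedBall_iff_norm, mem_closedBall_iff_norm]
        push_cast
        refine ⟨by nlinarith, ?_⟩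
        calc ‖y + h • e - x‖ = ‖(y - x) + h • e‖ := by congr 1; abel
          _ ≤ ‖y - x‖ + ‖h • e‖ := norm_add_le _ _
          _ = ‖y - x‖ + h := by rw [norm_smul, he, Real.norm_of_nonneg hh.le, mul_one]
          _ ≤ _ := by linarith
      have hGs : ContDiff ℝ ∞ (fun y => G (y + h • e)) := hG.comp (by fun_prop)
      have := ih (fun y => G (y + h • e) - G y) (hGs.sub hG) x (2 * A) (h * ε) (by positivity)
        (by positivity) (h • T.curryLeft e) ?_ ?_
      · rw [norm_smul, Real.norm_of_nonneg hh.le] at this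
        have h3 : h * ‖T.curryLeft e‖ ≤ h * (2 ^ (n+1) * A / h ^ (n+1) + ε) := by
          refine this.trans (le_of_eq ?_)
          field_simp
          ring
        exact le_of_mul_le_mul_left h3 hh
      · intro y hy
        obtain ⟨ha, hb⟩ := hsub y hy
        have := norm_sub_le (G (y + h • e)) (G y)
        linarith [h1 _ ha, h1 _ hb]
      · intro y hy
        obtain ⟨ha, hb⟩ := hsub y hy
        have e1 : iteratedFDeriv ℝ n (fun y => G (y + h • e) - G y) y
            = iteratedFDeriv ℝ n G (y + h • e) - iteratedFDeriv ℝ n G y := by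
          have := iteratedFDeriv_sub_apply (𝕜 := ℝ) (i := n) (x := y)
            (f := fun y => G (y + h • e)) (g := G)
            ((hGs.of_le (by exact_mod_cast le_top)).contDiffAt)
            ((hG.of_le (by exact_mod_cast le_top)).contDiffAt)
          rw [iteratedFDeriv_comp_add_right] at this
          exact this
        rw [e1]
        have hd : Differentiable ℝ (iteratedFDeriv ℝ n G) :=
          hG.differentiable_iteratedFDeriv (by exact_mod_cast ENat.natCast_lt_top n)
        have := aux_mv (iteratedFDeriv ℝ n G) hd x ((n+1 : ℕ) * h) T.curryLeft ε ?_ y (y + h • e) ha hb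
        · simpa [norm_smul, he, abs_of_pos hh, mul_comm] using this
        · intro z hz
          have h4 := h2 z hz
          rw [fderiv_iteratedFDeriv]
          refine le_trans (le_of_eq ?_) h4
          rw [← ContinuousMultilinearMap.curryLeft_norm]
          rfl
    rw [← ContinuousMultilinearMap.curryLeft_norm]
    exact ContinuousLinearMap.opNorm_le_of_unit_norm (by positivity) key

theorem aux_grad {E F : Type*} [NormedAddCommGroup E] [NormedSpace ℝ E]
    [NormedAddCommGroup F] [NormedSpace ℝ F] (G : E → F) (hG : ContDiff ℝ ∞ G) (n : ℕ)
    (x : E) (h A ε : ℝ) (hh : 0 < h) (hA : 0 ≤ A) (hε : 0 ≤ ε)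
    (h1 : ∀ y ∈ Metric.closedBall x h, ‖iteratedFDeriv ℝ n G y - iteratedFDeriv ℝ n G x‖ ≤ A)
    (h2 : ∀ y ∈ Metric.closedBall x h,
      ‖iteratedFDeriv ℝ (n+1) G y - iteratedFDeriv ℝ (n+1) G x‖ ≤ ε) :
    ‖iteratedFDeriv ℝ (n+1) G x‖ ≤ A / h + ε := by
  have hd : Differentiable ℝ (iteratedFDeriv ℝ n G) :=
    hG.differentiable_iteratedFDeriv (by exact_mod_cast ENat.natCast_lt_top n)
  rw [← norm_fderiv_iteratedFDeriv]
  refine ContinuousLinearMap.opNorm_le_of_unit_norm (by positivity) fun e he => ?_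
  have hb : x + h • e ∈ Metric.closedBall x h := by
    simp [norm_smul, he, abs_of_pos hh]
  have := aux_mv (iteratedFDeriv ℝ n G) hd x h (fderiv ℝ (iteratedFDeriv ℝ n G) x) ε ?_ x
    (x + h • e) (by simp [hh.le]) hb
  · have h3 := h1 _ hb
    simp only [add_sub_cancel_left, map_smul, norm_smul, he, Real.norm_of_nonneg hh.le, mul_one] at this
    set a := iteratedFDeriv ℝ n G (x + h • e) - iteratedFDeriv ℝ n G x
    set b := fderiv ℝ (iteratedFDeriv ℝ n G) x e
    have h4 := norm_sub_le a (a - h • b)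
    rw [sub_sub_cancel, norm_smul, Real.norm_of_nonneg hh.le] at h4
    have h5 : h * ‖b‖ ≤ h * (A / h + ε) := by
      have : h * (A / h + ε) = A + ε * h := by field_simp
      linarith
    exact le_of_mul_le_mul_left h5 hh
  · intro z hz
    refine le_trans (le_of_eq ?_) (h2 z hz)
    rw [fderiv_iteratedFDeriv, ← ContinuousMultilinearMap.curryLeft_norm]
    rfl

theorem aux_osc {E F : Type*} [NormedAddCommGroup E] [NormedSpace ℝ E]
    [NormedAddCommGroup F] [NormedSpace ℝ F] (G : E → F) (hG : ContDiff ℝ ∞ G) (n : ℕ)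
    (x : E) (R M : ℝ) (hR : 0 ≤ R) (hM : 0 ≤ M)
    (h2 : ∀ y ∈ Metric.closedBall x R, ‖iteratedFDeriv ℝ (n+1) G y‖ ≤ M) :
    ∀ y ∈ Metric.closedBall x R, ‖iteratedFDeriv ℝ n G y - iteratedFDeriv ℝ n G x‖ ≤ M * R := by
  intro y hy
  have hd : Differentiable ℝ (iteratedFDeriv ℝ n G) :=
    hG.differentiable_iteratedFDeriv (by exact_mod_cast ENat.natCast_lt_top n)
  have := aux_mv (iteratedFDeriv ℝ n G) hd x R 0 M (fun z hz => by
    rw [sub_zero, norm_fderiv_iteratedFDeriv]; exact h2 z hz) x y (by simp [hR]) hy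
  simp only [_root_.zero_apply, sub_zero] at this
  rw [mem_closedBall_iff_norm] at hy
  exact this.trans (by gcongr)

theorem aux_fd_time (η : ℝ) (hη : η ≠ 0) (p : ℕ) :
    ∀ (g : ℝ → ℝ) (_ : ContDiff ℝ ∞ g) (s : ℝ) (A ε T : ℝ) (_ : 0 ≤ A) (_ : 0 ≤ ε)
      (_ : ∀ r : ℝ, 0 ≤ r → r ≤ p → |g (s + r * η)| ≤ A)
      (_ : ∀ r : ℝ, 0 ≤ r → r ≤ p → |iteratedDeriv p g (s + r * η) - T| ≤ ε),
      |T| ≤ 2 ^ p * A / |η| ^ p + ε := by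
  have hη' : 0 < |η| := abs_pos.2 hη
  induction p with
  | zero =>
    intro g hg s A ε T hA hε h1 h2
    have a1 := h1 0 le_rfl (by simp)
    have a2 := h2 0 le_rfl (by simp)
    simp only [iteratedDeriv_zero] at a2
    have := abs_sub_abs_le_abs_sub T (g (s + 0 * η))
    rw [abs_sub_comm] at this
    simp; linarith
  | succ n ih =>
    intro g hg s A ε T hA hε h1 h2
    have hgs : ContDiff ℝ ∞ (fun y => g (y + η)) := hg.comp (by fun_prop)
    have hd : Differentiable ℝ (iteratedDeriv n g) :=
      hg.differentiable_iteratedDeriv n (by exact_mod_cast ENat.natCast_lt_top n)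
    have := ih (fun y => g (y + η) - g y) (hgs.sub hg) s (2 * A) (|η| * ε) (η * T) (by positivity)
        (by positivity) ?_ ?_
    · rw [abs_mul] at this
      have h3 : |η| * |T| ≤ |η| * (2 ^ (n+1) * A / |η| ^ (n+1) + ε) := by
        refine this.trans (le_of_eq ?_)
        field_simp
        ring
      exact le_of_mul_le_mul_left h3 hη'
    · intro r hr0 hr
      have a := h1 r hr0 (by push_cast; linarith)
      have b := h1 (r+1) (by linarith) (by push_cast; linarith)
      have e : s + (r+1) * η = s + r * η + η := by ring
      rw [e] at b
      have := abs_sub (g (s + r * η + η)) (g (s + r * η))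
      show |g (s + r * η + η) - g (s + r * η)| ≤ 2 * A
      linarith
    · intro r hr0 hr
      have e1 : iteratedDeriv n (fun y => g (y + η) - g y) (s + r * η)
            = iteratedDeriv n g (s + r * η + η) - iteratedDeriv n g (s + r * η) := by
        have := iteratedDeriv_fun_sub (𝕜 := ℝ) (n := n) (x := s + r * η)
            (f := fun y => g (y + η)) (g := g)
            ((hgs.of_le (by exact_mod_cast le_top)).contDiffAt)
            ((hg.of_le (by exact_mod_cast le_top)).contDiffAt)
        rw [iteratedDeriv_comp_add_const] at this
        exact this
      rw [e1]
      have e : s + r * η + η = s + (r+1) * η := by ring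
      rw [e]
      have hφ : ∀ y : ℝ, HasDerivAt (fun r : ℝ => iteratedDeriv n g (s + r * η) - r * η * T)
          (iteratedDeriv (n+1) g (s + y * η) * η - η * T) y := by
        intro y
        have i1 : HasDerivAt (fun r : ℝ => s + r * η) η y := by
          simpa using ((hasDerivAt_id y).mul_const η).const_add s
        have i2 := (hd (s + y * η)).hasDerivAt.comp y i1
        rw [← iteratedDeriv_succ] at i2
        have i3 : HasDerivAt (fun r : ℝ => r * η * T) (η * T) y := by
          simpa using ((hasDerivAt_id y).mul_const η).mul_const T
        exact i2.sub i3
      have := (convex_Icc r (r+1)).norm_image_sub_le_of_norm_hasDerivWithin_le (C := |η| * ε)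
        (fun y _ => (hφ y).hasDerivWithinAt) ?_ (Set.left_mem_Icc.2 (by linarith))
        (Set.right_mem_Icc.2 (by linarith))
      · simp only [Real.norm_eq_abs, add_sub_cancel_left, abs_one, mul_one] at this
        refine le_trans (le_of_eq ?_) this
        congr 1; ring
      · intro y hy
        have := h2 y (by linarith [hy.1]) (by push_cast; linarith [hy.2])
        rw [Real.norm_eq_abs, show iteratedDeriv (n+1) g (s + y * η) * η - η * T
          = η * (iteratedDeriv (n+1) g (s + y * η) - T) by ring, abs_mul]
        gcongr

theorem aux_smooth_time {E : Type*} [NormedAddCommGroup E] [NormedSpace ℝ E]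
    (u : E × ℝ → ℝ) (hu : ContDiff ℝ ∞ u) (q : ℕ) :
    ContDiff ℝ ∞ (fun z : E × ℝ => iteratedDeriv q (fun τ => u (z.1, τ)) z.2) := by
  induction q with
  | zero => simpa using hu
  | succ n ih =>
    set v : E × ℝ → ℝ := fun z : E × ℝ => iteratedDeriv n (fun τ => u (z.1, τ)) z.2 with hv
    have : (fun z : E × ℝ => iteratedDeriv (n+1) (fun τ => u (z.1, τ)) z.2)
        = fun z => fderiv ℝ v z (0, 1) := by
      ext z
      rw [iteratedDeriv_succ]
      have hd : HasFDerivAt v (fderiv ℝ v (z.1, z.2)) (z.1, z.2) :=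
        (ih.differentiable (by simp) _).hasFDerivAt
      have h2 : HasDerivAt (fun τ : ℝ => (z.1, τ)) ((0 : E), (1 : ℝ)) z.2 :=
        (hasDerivAt_const _ _).prodMk (hasDerivAt_id _)
      exact (hd.comp_hasDerivAt z.2 h2).deriv
    rw [this]
    exact (ih.fderiv_right (m := ∞) (by simp)).clm_apply contDiff_const

theorem aux_hol {d : ℕ} {u : EuclideanSpace ℝ (Fin d) × ℝ → ℝ} {ℓ : ℕ} {α : ℝ}
    {Q : Set (EuclideanSpace ℝ (Fin d) × ℝ)} {B : ℝ} (H : frakDHolderLE d u ℓ α Q B)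
    (p q : ℕ) (hpq : p + 2 * q = ℓ) (x : EuclideanSpace ℝ (Fin d)) (s : ℝ)
    (y : EuclideanSpace ℝ (Fin d)) (s' : ℝ) (hz : (x, s) ∈ Q) (hw : (y, s') ∈ Q) :
    ‖spaceTimeDeriv d u p q x s - spaceTimeDeriv d u p q y s'‖
      ≤ B * (‖x - y‖ + |s - s'| ^ ((1 : ℝ) / 2)) ^ α := by
  obtain ⟨M, hM, hs, hb⟩ := H
  have hp : p = ℓ - 2 * q := by omega
  subst hp
  have hq : q ∈ Finset.range (ℓ / 2 + 1) := by rw [Finset.mem_range]; omega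
  refine (hb q hq _ hz _ hw).trans ?_
  unfold parabolicDist
  have : M q ≤ B := (Finset.single_le_sum (fun i _ => hM i) hq).trans hs
  gcongr

theorem aux_norm_le {d : ℕ} {u : EuclideanSpace ℝ (Fin d) × ℝ → ℝ} {ℓ : ℕ}
    {z : EuclideanSpace ℝ (Fin d) × ℝ} {K : ℝ} (hK : 0 ≤ K)
    (H : ∀ p q, p + 2 * q = ℓ → ‖spaceTimeDeriv d u p q z.1 z.2‖ ≤ K) :
    frakDNorm d u ℓ z ≤ ((ℓ / 2 + 1 : ℕ) : ℝ) * K := by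
  unfold frakDNorm
  rw [Real.sqrt_le_left (by positivity)]
  calc _ ≤ ∑ q ∈ Finset.range (ℓ / 2 + 1), K ^ 2 := by
        refine Finset.sum_le_sum fun q hq => ?_
        have := H (ℓ - 2 * q) q (by rw [Finset.mem_range] at hq; omega)
        gcongr
    _ = ((ℓ / 2 + 1 : ℕ) : ℝ) * K ^ 2 := by simp
    _ ≤ _ := by
        rw [mul_pow]
        have : (1 : ℝ) ≤ ((ℓ / 2 + 1 : ℕ) : ℝ) := by push_cast; linarith [Nat.cast_nonneg (α := ℝ) (ℓ/2)]
        gcongr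
        nlinarith

theorem aux_eta (t s h : ℝ) (hh : 0 < h) (hh' : h ≤ 1 / 4) (hs : s ∈ Set.Icc (t - 1) t) :
    ∃ η : ℝ, η ≠ 0 ∧ |η| = h ^ 2 ∧ ∀ r, 0 ≤ r → r ≤ 2 → s + r * η ∈ Set.Icc (t - 1) t := by
  have h2 : 0 < h ^ 2 := by positivity
  have h3 : h ^ 2 ≤ 1 / 16 := by nlinarith
  obtain ⟨a, b⟩ := hs
  by_cases hc : s ≤ t - 1 / 2
  · refine ⟨h ^ 2, h2.ne', abs_of_pos h2, fun r hr0 hr => ⟨by nlinarith, by nlinarith⟩⟩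
  · refine ⟨-h ^ 2, by linarith, by rw [abs_neg, abs_of_pos h2], fun r hr0 hr => ⟨by nlinarith, by nlinarith⟩⟩

theorem aux_std_zero {d : ℕ} (u : EuclideanSpace ℝ (Fin d) × ℝ → ℝ) (q : ℕ)
    (x : EuclideanSpace ℝ (Fin d)) (s s' : ℝ) :
    ‖spaceTimeDeriv d u 0 q x s - spaceTimeDeriv d u 0 q x s'‖ =
      |iteratedDeriv q (fun τ => u (x, τ)) s - iteratedDeriv q (fun τ => u (x, τ)) s'| := by
  unfold spaceTimeDeriv
  rw [iteratedFDeriv_zero_eq_comp, iteratedFDeriv_zero_eq_comp]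
  simp only [Function.comp_apply]
  rw [← map_sub, LinearIsometryEquiv.norm_map, Real.norm_eq_abs]

theorem aux_std_zero' {d : ℕ} (u : EuclideanSpace ℝ (Fin d) × ℝ → ℝ) (q : ℕ)
    (x : EuclideanSpace ℝ (Fin d)) (s : ℝ) :
    ‖spaceTimeDeriv d u 0 q x s‖ = |iteratedDeriv q (fun τ => u (x, τ)) s| := by
  unfold spaceTimeDeriv
  rw [norm_iteratedFDeriv_zero, Real.norm_eq_abs]

theorem aux_smooth_x {d : ℕ} (u : EuclideanSpace ℝ (Fin d) × ℝ → ℝ) (hu : ContDiff ℝ ∞ u)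
    (q : ℕ) (s : ℝ) : ContDiff ℝ ∞ (fun y => iteratedDeriv q (fun τ => u (y, τ)) s) :=
  (aux_smooth_time u hu q).comp (f := fun y => (y, s)) (by fun_prop)

theorem aux_smooth_t {d : ℕ} (u : EuclideanSpace ℝ (Fin d) × ℝ → ℝ) (hu : ContDiff ℝ ∞ u)
    (q : ℕ) (x : EuclideanSpace ℝ (Fin d)) :
    ContDiff ℝ ∞ (fun s => iteratedDeriv q (fun τ => u (x, τ)) s) :=
  (aux_smooth_time u hu q).comp (f := fun s => (x, s)) (by fun_prop)

theorem aux_ball {E : Type*} [NormedAddCommGroup E] {x y : E} {r R c : ℝ}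
    (hx : ‖x‖ ≤ r) (hy : y ∈ Metric.closedBall x R) (hc : r + R ≤ c) : ‖y‖ ≤ c := by
  rw [mem_closedBall_iff_norm] at hy
  have := norm_add_le (y - x) x
  rw [sub_add_cancel] at this
  linarith

theorem aux_desc {E F : Type*} [NormedAddCommGroup E] [NormedSpace ℝ E]
    [NormedAddCommGroup F] [NormedSpace ℝ F] (G : E → F) (hG : ContDiff ℝ ∞ G) (n : ℕ)
    (h : ℝ) (hh : 0 < h) (ρ r A M : ℝ) (hA : 0 ≤ A) (hM : 0 ≤ M) (hr : r ≤ ρ)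
    (h1 : ∀ y, ‖y‖ ≤ ρ → ‖G y‖ ≤ A)
    (h2 : ∀ y, ‖y‖ ≤ r → ‖iteratedFDeriv ℝ (n+1) G y‖ ≤ M) :
    ∀ x, ‖x‖ ≤ r - n * h → ‖iteratedFDeriv ℝ n G x‖ ≤ 2 ^ n * A / h ^ n + M * (n * h) := by
  intro x hx
  have hn : 0 ≤ n * h := by positivity
  refine aux_fd_space h hh n G hG x A (M * (n * h)) hA (by positivity) _ ?_ ?_
  · exact fun y hy => h1 y (aux_ball hx hy (by linarith))
  · exact aux_osc G hG n x (n * h) M hn hM fun y hy => h2 y (aux_ball hx hy (by linarith))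

theorem aux_core4 {d : ℕ} (u : EuclideanSpace ℝ (Fin d) × ℝ → ℝ) (hu : ContDiff ℝ ∞ u)
    (α : ℝ) (hα0 : 0 < α) (hα1 : α < 1) (ρ t A B h : ℝ) (hA : 0 ≤ A) (hB : 0 ≤ B)
    (hh : 0 < h) (hh' : h ≤ 1 / 4) (hBA : B * h ^ α ≤ A / h ^ 4)
    (h1 : ∀ z ∈ parabolicCylinder d ρ t, |u z| ≤ A)
    (h2 : frakDHolderLE d u 4 α (parabolicCylinder d ρ t) B)
    (z : EuclideanSpace ℝ (Fin d) × ℝ) (hz : z ∈ parabolicCylinder d (ρ - 10 * h) t)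
    (ℓ : ℕ) (hℓ : ℓ ≤ 4) : frakDNorm d u ℓ z ≤ 426 * (A / h ^ ℓ) := by
  -- Hölder oscillation at parabolic scale `4h`
  have hosc : ∀ D : ℝ, 0 ≤ D → D ≤ 4 * h → B * D ^ α ≤ 4 * (A / h ^ 4) := by
    intro D hD0 hD
    have e1 : D ^ α ≤ (4 * h) ^ α := Real.rpow_le_rpow hD0 hD hα0.le
    rw [Real.mul_rpow (by norm_num) hh.le] at e1
    have e2 : (4 : ℝ) ^ α ≤ 4 := by
      have := Real.rpow_le_rpow_of_exponent_le (x := 4) (by norm_num) hα1.le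
      simpa using this
    have e3 : 0 ≤ h ^ α := by positivity
    have e4 : B * D ^ α ≤ B * (4 * h ^ α) := by
      apply mul_le_mul_of_nonneg_left _ hB
      exact e1.trans (by gcongr)
    linarith
  have hq4 : 0 ≤ A / h ^ 4 := by positivity
  -- time derivatives
  have T2 : ∀ x s, ‖x‖ ≤ ρ → s ∈ Set.Icc (t - 1) t →
      |iteratedDeriv 2 (fun τ => u (x, τ)) s| ≤ 8 * (A / h ^ 4) := by
    intro x s hx hs
    obtain ⟨η, hη0, hη, hr⟩ := aux_eta t s h hh hh' hs
    have := aux_fd_time η hη0 2 (fun τ => u (x, τ)) (by simpa using aux_smooth_t u hu 0 x) s A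
      (4 * (A / h ^ 4)) (iteratedDeriv 2 (fun τ => u (x, τ)) s) hA (by positivity) ?_ ?_
    · rw [hη] at this
      refine this.trans (le_of_eq ?_)
      field_simp; ring
    · intro r hr0 hr2
      exact h1 _ ⟨hx, hr r hr0 (by simpa using hr2)⟩
    · intro r hr0 hr2
      have hr2' : r ≤ 2 := by simpa using hr2
      rw [← aux_std_zero]
      refine (aux_hol h2 0 2 (by norm_num) _ _ _ _ ⟨hx, hr r hr0 hr2'⟩ ⟨hx, hs⟩).trans ?_
      refine hosc _ (by positivity) ?_
      rw [sub_self, norm_zero, zero_add, add_sub_cancel_left, abs_mul, hη, abs_of_nonneg hr0,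
        ← Real.sqrt_eq_rpow]
      refine Real.sqrt_le_iff.2 ⟨by positivity, by nlinarith [sq_nonneg h]⟩
  have T1 : ∀ x s, ‖x‖ ≤ ρ → s ∈ Set.Icc (t - 1) t →
      |iteratedDeriv 1 (fun τ => u (x, τ)) s| ≤ 10 * (A / h ^ 2) := by
    intro x s hx hs
    obtain ⟨η, hη0, hη, hr⟩ := aux_eta t s h hh hh' hs
    have := aux_fd_time η hη0 1 (fun τ => u (x, τ)) (by simpa using aux_smooth_t u hu 0 x) s A
      (8 * (A / h ^ 4) * h ^ 2) (iteratedDeriv 1 (fun τ => u (x, τ)) s) hA (by positivity) ?_ ?_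
    · rw [hη] at this
      refine this.trans (le_of_eq ?_)
      field_simp; ring
    · intro r hr0 hr2
      exact h1 _ ⟨hx, hr r hr0 (by simp at hr2; linarith)⟩
    · intro r hr0 hr2
      have hr2' : r ≤ 1 := by simpa using hr2
      have := (convex_Icc (t-1) t).norm_image_sub_le_of_norm_deriv_le
        (f := iteratedDeriv 1 (fun τ => u (x, τ))) (C := 8 * (A / h ^ 4))
        (fun y _ => (aux_smooth_t u hu 1 x).differentiable (by simp) y)
        (fun y hy => by
          rw [← iteratedDeriv_succ, Real.norm_eq_abs]; exact T2 x y hx hy)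
        hs (hr r hr0 (by linarith))
      rw [Real.norm_eq_abs] at this
      refine this.trans ?_
      rw [add_sub_cancel_left, norm_mul, Real.norm_eq_abs, Real.norm_eq_abs, hη, abs_of_nonneg hr0]
      gcongr
      nlinarith [sq_nonneg h]
  -- space derivatives
  obtain ⟨x, s⟩ := z
  obtain ⟨hx, hs⟩ := hz
  change s ∈ Set.Icc (t - 1) t at hs
  change ‖x‖ ≤ ρ - 10 * h at hx
  have b0 : ∀ y, ‖y‖ ≤ ρ → ‖(fun y => iteratedDeriv 0 (fun τ => u (y, τ)) s) y‖ ≤ A := by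
    intro y hy
    simpa using h1 (y, s) ⟨hy, hs⟩
  have b1 : ∀ y, ‖y‖ ≤ ρ → ‖(fun y => iteratedDeriv 1 (fun τ => u (y, τ)) s) y‖
      ≤ 10 * (A / h ^ 2) := fun y hy => T1 y s hy hs
  have top : ∀ p q : ℕ, p + 2 * q = 4 → ∀ y y', ‖y‖ ≤ ρ - p * h → y' ∈ Metric.closedBall y (p * h) →
      ‖spaceTimeDeriv d u p q y' s - spaceTimeDeriv d u p q y s‖ ≤ 4 * (A / h ^ 4) := by
    intro p q hpq y y' hy hy'
    have hp : (p : ℝ) ≤ 4 := by exact_mod_cast (by omega : p ≤ 4)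
    have hp0 : 0 ≤ p * h := by positivity
    refine (aux_hol h2 p q hpq _ _ _ _ ⟨aux_ball hy hy' (by linarith), hs⟩
      ⟨by show ‖y‖ ≤ ρ; linarith, hs⟩).trans (hosc _ (by positivity) ?_)
    rw [mem_closedBall_iff_norm] at hy'
    rw [sub_self, abs_zero, Real.zero_rpow (by norm_num), add_zero]
    exact hy'.trans (by gcongr)
  have N4 : ∀ y, ‖y‖ ≤ ρ - 4 * h → ‖spaceTimeDeriv d u 4 0 y s‖ ≤ 20 * (A / h ^ 4) := by
    intro y hy
    refine (aux_fd_space h hh 4 _ (aux_smooth_x u hu 0 s) y A (4 * (A / h ^ 4)) hA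
      (by positivity) _ (fun y' hy' => b0 y' (aux_ball hy hy' (by push_cast; linarith)))
      (fun y' hy' => top 4 0 (by norm_num) y y' (by exact_mod_cast hy) hy')).trans (le_of_eq ?_)
    ring
  have N3 : ∀ y, ‖y‖ ≤ ρ - 4 * h - (3 : ℕ) * h → ‖spaceTimeDeriv d u 3 0 y s‖ ≤ 68 * (A / h ^ 3) := by
    intro y hy
    refine (aux_desc _ (aux_smooth_x u hu 0 s) 3 h hh ρ _ A _ hA (by positivity) (by linarith) b0 N4
      y hy).trans (le_of_eq ?_)
    push_cast; field_simp; ring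
  have N2 : ∀ y, ‖y‖ ≤ ρ - 4 * h - (3 : ℕ) * h - (2 : ℕ) * h →
      ‖spaceTimeDeriv d u 2 0 y s‖ ≤ 140 * (A / h ^ 2) := by
    intro y hy
    refine (aux_desc _ (aux_smooth_x u hu 0 s) 2 h hh ρ _ A _ hA (by positivity)
      (by push_cast; linarith) b0 N3 y hy).trans (le_of_eq ?_)
    push_cast; field_simp; ring
  have N1 : ∀ y, ‖y‖ ≤ ρ - 4 * h - (3 : ℕ) * h - (2 : ℕ) * h - (1 : ℕ) * h →
      ‖spaceTimeDeriv d u 1 0 y s‖ ≤ 142 * (A / h ^ 1) := by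
    intro y hy
    refine (aux_desc _ (aux_smooth_x u hu 0 s) 1 h hh ρ _ A _ hA (by positivity)
      (by push_cast; linarith) b0 N2 y hy).trans (le_of_eq ?_)
    push_cast; field_simp; ring
  have P2 : ∀ y, ‖y‖ ≤ ρ - 2 * h → ‖spaceTimeDeriv d u 2 1 y s‖ ≤ 44 * (A / h ^ 4) := by
    intro y hy
    refine (aux_fd_space h hh 2 _ (aux_smooth_x u hu 1 s) y _ (4 * (A / h ^ 4)) (by positivity)
      (by positivity) _ (fun y' hy' => b1 y' (aux_ball hy hy' (by push_cast; linarith)))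
      (fun y' hy' => top 2 1 (by norm_num) y y' (by exact_mod_cast hy) hy')).trans (le_of_eq ?_)
    field_simp; ring
  have P1 : ∀ y, ‖y‖ ≤ ρ - 2 * h - (1 : ℕ) * h → ‖spaceTimeDeriv d u 1 1 y s‖ ≤ 64 * (A / h ^ 3) := by
    intro y hy
    refine (aux_desc _ (aux_smooth_x u hu 1 s) 1 h hh ρ _ _ _ (by positivity) (by positivity)
      (by linarith) b1 P2 y hy).trans (le_of_eq ?_)
    push_cast; field_simp; ring
  have hx0 : ‖x‖ ≤ ρ := by linarith
  refine (aux_norm_le (K := 142 * (A / h ^ ℓ)) (by positivity) ?_).trans ?_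
  · rintro p q rfl
    have hq : 0 ≤ A / h ^ (p + 2 * q) := by positivity
    have hcase : (p, q) ∈ ({(0,0),(1,0),(2,0),(3,0),(4,0),(0,1),(1,1),(2,1),(0,2)} : Finset (ℕ × ℕ)) := by
      have : q ≤ 2 := by omega
      have : p ≤ 4 := by omega
      interval_cases q <;> interval_cases p <;> first | omega | decide
    simp only [Finset.mem_insert, Finset.mem_singleton, Prod.mk.injEq] at hcase
    rcases hcase with ⟨rfl, rfl⟩ | ⟨rfl, rfl⟩ | ⟨rfl, rfl⟩ | ⟨rfl, rfl⟩ | ⟨rfl, rfl⟩ | ⟨rfl, rfl⟩ |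
      ⟨rfl, rfl⟩ | ⟨rfl, rfl⟩ | ⟨rfl, rfl⟩
    · rw [aux_std_zero']
      have := b0 x hx0
      simp only [Real.norm_eq_abs] at this
      norm_num at hq ⊢
      norm_num at this
      linarith
    · exact N1 x (by push_cast; linarith)
    · exact (N2 x (by push_cast; linarith)).trans (by norm_num at hq ⊢; linarith)
    · exact (N3 x (by push_cast; linarith)).trans (by norm_num at hq ⊢; linarith)
    · exact (N4 x (by linarith)).trans (by norm_num at hq ⊢; linarith)
    · rw [aux_std_zero']
      exact (T1 x s hx0 hs).trans (by norm_num at hq ⊢; linarith)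
    · exact (P1 x (by push_cast; linarith)).trans (by norm_num at hq ⊢; linarith)
    · exact (P2 x (by linarith)).trans (by norm_num at hq ⊢; linarith)
    · rw [aux_std_zero']
      exact (T2 x s hx0 hs).trans (by norm_num at hq ⊢; linarith)
  · have : ((ℓ / 2 + 1 : ℕ) : ℝ) ≤ 3 := by exact_mod_cast (by omega : ℓ / 2 + 1 ≤ 3)
    have hq : 0 ≤ A / h ^ ℓ := by positivity
    nlinarith

theorem aux_core5 {d : ℕ} (u : EuclideanSpace ℝ (Fin d) × ℝ → ℝ) (hu : ContDiff ℝ ∞ u)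
    (α : ℝ) (hα0 : 0 < α) (ρ t h B₀ B₁ B₂ : ℝ) (hB₀ : 0 ≤ B₀) (hB₁ : 0 ≤ B₁)
    (hB₂ : 0 ≤ B₂) (hh : 0 < h) (hh' : h ≤ 1 / 4) (m : ℕ)
    (h1 : frakDHolderLE d u (m + 1) α (parabolicCylinder d ρ t) B₁)
    (h2 : frakDHolderLE d u (m + 2) α (parabolicCylinder d ρ t) B₂)
    (x : EuclideanSpace ℝ (Fin d)) (s : ℝ) (hx : ‖x‖ ≤ ρ - h) (hs : s ∈ Set.Icc (t - 1) t)
    (p q : ℕ) (hpq : p + 2 * q = m + 2)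
    (h0 : p = 0 → frakDHolderLE d u m α (parabolicCylinder d ρ t) B₀) :
    ‖spaceTimeDeriv d u p q x s‖
      ≤ B₁ * h ^ α / h + B₀ * h ^ α * 2 / h ^ 2 + B₂ * h ^ α := by
  have hx0 : ‖x‖ ≤ ρ := by linarith
  rcases p with _ | n
  · obtain ⟨j, rfl⟩ : ∃ j, q = j + 1 := ⟨q - 1, by omega⟩
    rw [aux_std_zero']
    obtain ⟨η, hη0, hη, hr⟩ := aux_eta t s h hh hh' hs
    have hD : ∀ r : ℝ, 0 ≤ r → r ≤ 1 →
        (‖x - x‖ + |s + r * η - s| ^ ((1:ℝ)/2)) ^ α ≤ h ^ α := by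
      intro r hr0 hr1
      refine Real.rpow_le_rpow (by positivity) ?_ hα0.le
      rw [sub_self, norm_zero, zero_add, add_sub_cancel_left, abs_mul, hη, abs_of_nonneg hr0,
        ← Real.sqrt_eq_rpow]
      refine Real.sqrt_le_iff.2 ⟨by positivity, by nlinarith [sq_nonneg h]⟩
    have hsm := aux_smooth_t u hu j x
    have := aux_fd_time η hη0 1
      (fun τ => iteratedDeriv j (fun τ => u (x, τ)) τ - iteratedDeriv j (fun τ => u (x, τ)) s)
      (hsm.sub contDiff_const) s (B₀ * h ^ α)
      (B₂ * h ^ α) (iteratedDeriv (j+1) (fun τ => u (x, τ)) s) (by positivity) (by positivity) ?_ ?_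
    · rw [hη] at this
      refine this.trans ?_
      have : 0 ≤ B₁ * h ^ α / h := by positivity
      rw [pow_one, pow_one, mul_comm 2]
      linarith
    · intro r hr0 hr2
      have hr2' : r ≤ 1 := by simpa using hr2
      rw [← aux_std_zero]
      refine (aux_hol (h0 rfl) 0 j (by omega) _ _ _ _ ⟨hx0, hr r hr0 (by linarith)⟩ ⟨hx0, hs⟩).trans ?_
      exact mul_le_mul_of_nonneg_left (hD r hr0 hr2') hB₀
    · intro r hr0 hr2
      have hr2' : r ≤ 1 := by simpa using hr2
      rw [iteratedDeriv_one, deriv_sub_const, ← iteratedDeriv_succ, ← aux_std_zero]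
      refine (aux_hol h2 0 (j+1) (by omega) _ _ _ _ ⟨hx0, hr r hr0 (by linarith)⟩ ⟨hx0, hs⟩).trans ?_
      exact mul_le_mul_of_nonneg_left (hD r hr0 hr2') hB₂
  · have hD : ∀ y ∈ Metric.closedBall x h, 
        (‖y - x‖ + |s - s| ^ ((1:ℝ)/2)) ^ α ≤ h ^ α := by
      intro y hy
      refine Real.rpow_le_rpow (by positivity) ?_ hα0.le
      rw [mem_closedBall_iff_norm] at hy
      rwa [sub_self, abs_zero, Real.zero_rpow (by norm_num), add_zero]
    have := aux_grad _ (aux_smooth_x u hu q s) n x h (B₁ * h ^ α) (B₂ * h ^ α) hh (by positivity)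
      (by positivity) ?_ ?_
    · refine this.trans ?_
      have : 0 ≤ B₀ * h ^ α * 2 / h ^ 2 := by positivity
      linarith
    · intro y hy
      refine (aux_hol h1 n q (by omega) _ _ _ _ ⟨aux_ball hx hy (by linarith), hs⟩ ⟨hx0, hs⟩).trans ?_
      exact mul_le_mul_of_nonneg_left (hD y hy) hB₁
    · intro y hy
      refine (aux_hol h2 (n+1) q (by omega) _ _ _ _ ⟨aux_ball hx hy (by linarith), hs⟩ ⟨hx0, hs⟩).trans ?_
      exact mul_le_mul_of_nonneg_left (hD y hy) hB₂

/-- Interpolation estimates for the second-order expansion coefficients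
(Lemma 3.3 of the paper, in conditional form). -/
theorem interp_second_order_coefficients
    (d : ℕ) (hd : 1 ≤ d) (ρ ρ' : ℝ) (hρ' : 0 < ρ') (hρ : ρ' < ρ)
    (α : ℝ) (hα0 : 0 < α) (hα1 : α < 1) (k : ℕ) (hk : 4 ≤ k) (C₀ : ℝ) (hC₀ : 0 < C₀)
    (u : EuclideanSpace ℝ (Fin d) × ℝ → ℝ) (hu : ContDiff ℝ (⊤ : ℕ∞) u)
    (h1 : ∀ t ≥ (1 : ℝ), ∀ z ∈ parabolicCylinder d ρ t, |u z| ≤ C₀ * Real.exp (-(4 + α) * t / 2))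
    (h2 : ∀ t ≥ (1 : ℝ), frakDHolderLE d u 4 α (parabolicCylinder d ρ t) (C₀ * Real.exp (-t)))
    (h3 : ∀ t ≥ (1 : ℝ), ∀ ℓ : ℕ, 4 ≤ ℓ → ℓ ≤ 2 * k + 6 →
      frakDHolderLE d u ℓ α (parabolicCylinder d ρ t)
        (C₀ * Real.exp (((ℓ : ℝ) - 6) * t / 2))) :
    ∃ C > 0, ∀ t ≥ (1 : ℝ),
      (∀ ℓ : ℕ, ℓ ≤ 4 → ∀ z ∈ parabolicCylinder d ρ' t,
        frakDNorm d u ℓ z ≤ C * Real.exp (-(t / 2) * (4 + α - (2 + α) * (ℓ : ℝ) / (4 + α)))) ∧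
      (∀ ℓ : ℕ, 4 ≤ ℓ → ℓ ≤ 2 * k + 6 → ∀ z ∈ parabolicCylinder d ρ' t,
        frakDNorm d u ℓ z ≤
          C * Real.exp (-(t / 2) * (4 + ((ℓ : ℝ) * (2 - (ℓ : ℝ)) + α ^ 2) / ((ℓ : ℝ) + α)))) := by
  have hu' : ContDiff ℝ ∞ u := hu
  obtain ⟨h0, hh0, hh1, hh2⟩ : ∃ h0 : ℝ, 0 < h0 ∧ h0 ≤ 1 / 4 ∧ 10 * h0 ≤ ρ - ρ' := by
    refine ⟨min (1 / 4) ((ρ - ρ') / 10), lt_min (by norm_num) (by linarith), min_le_left _ _, ?_⟩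
    have := min_le_right (1 / 4) ((ρ - ρ') / 10)
    linarith
  -- first family
  have first : ∀ t ≥ (1 : ℝ), ∀ ℓ : ℕ, ℓ ≤ 4 → ∀ z ∈ parabolicCylinder d ρ' t,
      frakDNorm d u ℓ z ≤ 426 * C₀ / h0 ^ 4 *
        Real.exp (-(t / 2) * (4 + α - (2 + α) * (ℓ : ℝ) / (4 + α))) := by
    intro t ht ℓ hℓ z hz
    set w : ℝ := -(t / 2) * ((2 + α) / (4 + α)) with hw
    have hw0 : w ≤ 0 := by
      rw [hw]
      have : 0 ≤ (t / 2) * ((2 + α) / (4 + α)) := by positivity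
      linarith
    have hl1 : Real.exp w ≤ 1 := Real.exp_le_one_iff.2 hw0
    have hl0 := Real.exp_pos w
    have hpos : 0 < h0 * Real.exp w := by positivity
    have hle : h0 * Real.exp w ≤ h0 := by nlinarith
    have hle' : h0 * Real.exp w ≤ Real.exp w := by nlinarith
    have hBA : C₀ * Real.exp (-t) * (h0 * Real.exp w) ^ α ≤
        C₀ * Real.exp (-(4 + α) * t / 2) / (h0 * Real.exp w) ^ 4 := by
      rw [le_div_iff₀ (by positivity)]
      calc _ ≤ C₀ * Real.exp (-t) * (Real.exp w) ^ α * (Real.exp w) ^ 4 := by gcongr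
        _ = _ := by
          rw [← Real.exp_mul, ← Real.exp_nat_mul, mul_assoc, mul_assoc, ← Real.exp_add,
            ← Real.exp_add]
          congr 2
          rw [hw]; field_simp; push_cast; ring
    have hz' : z ∈ parabolicCylinder d (ρ - 10 * (h0 * Real.exp w)) t :=
      ⟨hz.1.trans (by linarith), hz.2⟩
    refine (aux_core4 u hu' α hα0 hα1 ρ t _ _ _ (by positivity) (by positivity) hpos
      (by linarith) hBA (h1 t ht) (h2 t ht) z hz' ℓ hℓ).trans ?_
    have e1 : C₀ * Real.exp (-(4 + α) * t / 2) / (h0 * Real.exp w) ^ ℓ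
        = C₀ / h0 ^ ℓ * Real.exp (-(t / 2) * (4 + α - (2 + α) * (ℓ : ℝ) / (4 + α))) := by
      rw [mul_pow, mul_div_mul_comm, ← Real.exp_nat_mul, ← Real.exp_sub]
      congr 2
      rw [hw]; field_simp; ring
    rw [e1]
    have e2 : h0 ^ 4 ≤ h0 ^ ℓ := pow_le_pow_of_le_one hh0.le (by linarith) hℓ
    have e3 : C₀ / h0 ^ ℓ ≤ C₀ / h0 ^ 4 := by gcongr
    rw [← mul_assoc]
    gcongr
    rw [mul_div_assoc]
    linarith
  -- second family, `ℓ ≥ 5`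
  have second : ∀ t ≥ (1 : ℝ), ∀ ℓ : ℕ, 5 ≤ ℓ → ℓ ≤ 2 * k + 6 → ∀ z ∈ parabolicCylinder d ρ' t,
      frakDNorm d u ℓ z ≤ (k + 4) * (4 * C₀ / h0 ^ 2) *
        Real.exp ((t / 2) * (ℓ - 6 - α)) := by
    intro t ht ℓ hℓ hℓ' z hz
    obtain ⟨m, rfl⟩ : ∃ m, ℓ = m + 2 := ⟨ℓ - 2, by omega⟩
    set w : ℝ := -(t / 2) with hw
    have hl1 : Real.exp w ≤ 1 := Real.exp_le_one_iff.2 (by rw [hw]; linarith)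
    have hl0 := Real.exp_pos w
    have hpos : 0 < h0 * Real.exp w := by positivity
    have hle : h0 * Real.exp w ≤ h0 := by nlinarith
    have hle' : h0 * Real.exp w ≤ Real.exp w := by nlinarith
    set h := h0 * Real.exp w with hhdef
    set X := Real.exp ((t / 2) * (((m + 2 : ℕ) : ℝ) - 6 - α)) with hX
    have hha : h ^ α ≤ Real.exp (w * α) := by
      rw [Real.exp_mul]; gcongr
    have i1 : C₀ * Real.exp ((((m + 1 : ℕ) : ℝ) - 6) * t / 2) * h ^ α / h ≤ C₀ / h0 ^ 2 * X := by
      calc _ ≤ C₀ * Real.exp ((((m + 1 : ℕ) : ℝ) - 6) * t / 2) * Real.exp (w * α) / h := by gcongr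
        _ = C₀ / h0 * X := by
          rw [hhdef, mul_assoc, ← Real.exp_add, mul_div_mul_comm, ← Real.exp_sub, hX]
          congr 2
          rw [hw]; push_cast; ring
        _ ≤ _ := by
          have : h0 ^ 2 ≤ h0 := by nlinarith
          gcongr
    have i0 : C₀ * Real.exp (((m : ℝ) - 6) * t / 2) * h ^ α * 2 / h ^ 2 ≤ 2 * (C₀ / h0 ^ 2 * X) := by
      calc _ ≤ C₀ * Real.exp (((m : ℝ) - 6) * t / 2) * Real.exp (w * α) * 2 / h ^ 2 := by gcongr
        _ = 2 * (C₀ * Real.exp (((m : ℝ) - 6) * t / 2 + w * α) / h ^ 2) := by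
          rw [Real.exp_add]; ring
        _ = 2 * (C₀ / h0 ^ 2 * X) := by
          rw [hhdef, mul_pow, mul_div_mul_comm, ← Real.exp_nat_mul, ← Real.exp_sub, hX]
          congr 3
          rw [hw]; push_cast; ring
    have i2 : C₀ * Real.exp ((((m + 2 : ℕ) : ℝ) - 6) * t / 2) * h ^ α ≤ C₀ / h0 ^ 2 * X := by
      calc _ ≤ C₀ * Real.exp ((((m + 2 : ℕ) : ℝ) - 6) * t / 2) * Real.exp (w * α) := by gcongr
        _ = C₀ * X := by
          rw [mul_assoc, ← Real.exp_add, hX]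
          congr 2
          rw [hw]; push_cast; ring
        _ ≤ _ := by
          have : h0 ^ 2 ≤ 1 := by nlinarith
          gcongr
          rw [le_div_iff₀ (by positivity)]
          nlinarith
    refine (aux_norm_le (K := 4 * C₀ / h0 ^ 2 * X) (by positivity) ?_).trans ?_
    · intro p q hpq
      refine (aux_core5 u hu' α hα0 ρ t h _ _ _ (by positivity) (by positivity) (by positivity)
        hpos (by linarith) m (h3 t ht (m + 1) (by omega) (by omega))
        (h3 t ht (m + 2) (by omega) (by omega)) z.1 z.2 (hz.1.trans (by linarith)) hz.2 p q hpq
        (fun hp => h3 t ht m (by omega) (by omega))).trans ?_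
      have : 4 * C₀ / h0 ^ 2 * X = 4 * (C₀ / h0 ^ 2 * X) := by ring
      rw [this]
      linarith
    · rw [mul_assoc]
      have : (((m + 2) / 2 + 1 : ℕ) : ℝ) ≤ k + 4 := by
        exact_mod_cast (by omega : (m + 2) / 2 + 1 ≤ k + 4)
      gcongr
  refine ⟨426 * C₀ / h0 ^ 4 + (k + 4) * (4 * C₀ / h0 ^ 2), by positivity, fun t ht => ⟨?_, ?_⟩⟩
  · intro ℓ hℓ z hz
    refine (first t ht ℓ hℓ z hz).trans ?_
    gcongr
    have : 0 ≤ (k + 4) * (4 * C₀ / h0 ^ 2) := by positivity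
    linarith
  · intro ℓ hℓ hℓ' z hz
    rcases hℓ.eq_or_lt with rfl | hlt
    · refine (first t ht 4 le_rfl z hz).trans ?_
      have e : 4 + α - (2 + α) * ((4 : ℕ) : ℝ) / (4 + α)
          = 4 + (((4 : ℕ) : ℝ) * (2 - ((4 : ℕ) : ℝ)) + α ^ 2) / (((4 : ℕ) : ℝ) + α) := by
        push_cast; field_simp; ring
      rw [e]
      gcongr
      have : 0 ≤ (k + 4) * (4 * C₀ / h0 ^ 2) := by positivity
      linarith
    · refine (second t ht ℓ hlt hℓ' z hz).trans ?_
      have e : (t / 2) * ((ℓ : ℝ) - 6 - α) ≤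
          -(t / 2) * (4 + ((ℓ : ℝ) * (2 - (ℓ : ℝ)) + α ^ 2) / ((ℓ : ℝ) + α)) := by
        have hp : 0 < (ℓ : ℝ) + α := by positivity
        have : ((ℓ : ℝ) * (2 - (ℓ : ℝ)) + α ^ 2) / ((ℓ : ℝ) + α) ≤ 2 - ℓ + α := by
          rw [div_le_iff₀ hp]; nlinarith
        nlinarith
      have : 0 ≤ 426 * C₀ / h0 ^ 4 := by positivity
      gcongr
      linarith
end

section
/- Higher-order interpolation estimate with improved decay exponent (estimate (5.11), part of Lemma 5.6 of the paper, in conditional form): Let α ∈ (4/5, 1), let k ≥ 10 be an integer, and let C₀ > 0. Suppose v : ℝ^d × ℝ → ℝ is smooth and for every t ≥ 1 satisfies (i) sup_{Q_ρ(t)} |v| ≤ C₀ e^{−(4+α)(1 − 2/(12+α))t/2}, (ii) [𝔇⁸v]_{α,Q_ρ(t)} ≤ C₀ e^{−t}, and (iii) [𝔇^ℓ v]_{α,Q_ρ(t)} ≤ C₀ e^{(ℓ−10)t/2} for every integer 8 ≤ ℓ ≤ 2k+10. Then there exist β ∈ (0, α) and C > 0 such that for every t ≥ 1: sup_{Q_{ρ′}(t)}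 |𝔇^ℓ v| ≤ C e^{−(t/2)(4 + β − (2+β)ℓ/(8+α))} for every integer 0 ≤ ℓ ≤ 8, and sup_{Q_{ρ′}(t)} |𝔇^ℓ v| ≤ C e^{−(t/2)(4 − (ℓ(ℓ−6) − αβ)/(ℓ+α))} for every integer 8 ≤ ℓ ≤ 2k+10. -/
open Real Finset

/-- Taylor estimate for a chain of successive derivatives. -/
lemma taylor_chain (n : ℕ) : ∀ (g : ℕ → ℝ → ℝ) (h H : ℝ), 0 ≤ h →
    (∀ j < n, ∀ s, HasDerivAt (g j) (g (j + 1) s) s) →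
    (∀ s, 0 ≤ s → s ≤ h → |g n s - g n 0| ≤ H) →
    ∀ s, 0 ≤ s → s ≤ h →
      |g 0 s - ∑ i ∈ Finset.range (n + 1), g i 0 * s ^ i / (i.factorial : ℝ)| ≤ H * s ^ n := by
  induction n with
  | zero =>
    intro g h H hh _ hH s hs hsh
    simpa using hH s hs hsh
  | succ n ih =>
    intro g h H hh hg hH s hs hsh
    have hH0 : 0 ≤ H := (abs_nonneg _).trans (hH 0 le_rfl hh)
    have key := ih (fun j => g (j + 1)) h H hh (fun j hj s => hg (j + 1) (by omega) s) hH
    set R : ℝ → ℝ := fun s => g 0 s - ∑ i ∈ Finset.range (n + 2), g i 0 * s ^ i / (i.factorial : ℝ)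
      with hR
    set R' : ℝ → ℝ := fun s => g 1 s -
      ∑ i ∈ Finset.range (n + 1), g (i + 1) 0 * s ^ i / (i.factorial : ℝ) with hR'
    have hder : ∀ s, HasDerivAt R (R' s) s := by
      intro s
      refine (hg 0 (by omega) s).sub ?_
      have h1 : HasDerivAt (fun s : ℝ => ∑ i ∈ Finset.range (n + 2),
          g i 0 * s ^ i / (i.factorial : ℝ))
          (∑ i ∈ Finset.range (n + 2), g i 0 * ((i : ℝ) * s ^ (i - 1)) / (i.factorial : ℝ)) s := by
        refine HasDerivAt.fun_sum fun i _ => ?_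
        exact ((hasDerivAt_pow i s).const_mul (g i 0)).div_const _
      refine h1.congr_deriv ?_
      rw [Finset.sum_range_succ' _ (n + 1)]
      simp only [Nat.cast_zero, zero_mul, mul_zero, zero_div, add_zero]
      refine Finset.sum_congr rfl fun i _ => ?_
      rw [Nat.factorial_succ]
      have : ((i : ℝ) + 1) ≠ 0 := by positivity
      have : (i.factorial : ℝ) ≠ 0 := by positivity
      push_cast
      field_simp
      try simp
    have hR0 : R 0 = 0 := by
      simp only [hR]
      rw [Finset.sum_range_succ' _ (n + 1)]
      simp
    have hb := norm_image_sub_le_of_norm_deriv_le_segment' (f := R) (f' := R')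
      (a := 0) (b := s) (C := H * s ^ n)
      (fun x _ => (hder x).hasDerivWithinAt) (fun x hx => by
        rw [Real.norm_eq_abs]
        refine (key x hx.1 (hx.2.le.trans hsh)).trans ?_
        exact mul_le_mul_of_nonneg_left (pow_le_pow_left₀ hx.1 hx.2.le n) hH0) s ⟨hs, le_rfl⟩
    rw [hR0, sub_zero, sub_zero, Real.norm_eq_abs] at hb
    calc _ ≤ H * s ^ n * s := hb
      _ = H * s ^ (n + 1) := by ring

/-- Coefficients of a polynomial are controlled by its values on `[0,1]`. -/
lemma coeff_bound (n : ℕ) : ∃ K : ℝ, 0 ≤ K ∧ ∀ (c : ℕ → ℝ) (M : ℝ),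
    (∀ y, 0 ≤ y → y ≤ 1 → |∑ i ∈ Finset.range (n + 1), c i * y ^ i| ≤ M) →
    ∀ j ≤ n, |c j| ≤ K * M := by
  let x : Fin (n + 1) → ℝ := fun k => (k : ℝ) / (n + 1)
  have hx : Function.Injective x := by
    intro a b hab
    have h0 : ((n : ℝ) + 1) ≠ 0 := by positivity
    have : (a : ℝ) = (b : ℝ) := by
      simpa [x, div_left_inj' h0] using hab
    exact Fin.ext (by exact_mod_cast this)
  let V := Matrix.vandermonde x
  have hV : IsUnit V.det := isUnit_iff_ne_zero.2 (Matrix.det_vandermonde_ne_zero_iff.2 hx)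
  refine ⟨∑ j, ∑ k, |V⁻¹ j k|, by positivity, ?_⟩
  intro c M hM j hj
  have hM0 : 0 ≤ M := (abs_nonneg _).trans (hM 0 le_rfl zero_le_one)
  let cv : Fin (n + 1) → ℝ := fun i => c i
  have h1 : V⁻¹.mulVec (V.mulVec cv) = cv := by
    rw [Matrix.mulVec_mulVec, Matrix.nonsing_inv_mul V hV, Matrix.one_mulVec]
  have h2 : ∀ k, |V.mulVec cv k| ≤ M := by
    intro k
    have hk : x k ≤ 1 := by
      simp only [x]
      rw [div_le_one (by positivity)]
      have : (k : ℕ) ≤ n := by omega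
      have : ((k : ℕ) : ℝ) ≤ n := by exact_mod_cast this
      linarith
    have := hM (x k) (by simp only [x]; positivity) hk
    rw [Finset.sum_range] at this
    convert this using 2
    simp only [Matrix.mulVec, dotProduct, V, Matrix.vandermonde_apply, cv]
    exact Finset.sum_congr rfl fun i _ => mul_comm _ _
  have hj' : j < n + 1 := by omega
  have h3 : c j = ∑ k, V⁻¹ ⟨j, hj'⟩ k * V.mulVec cv k := by
    have := congrFun h1 ⟨j, hj'⟩
    simp only [cv] at this
    rw [← this]
    rfl
  rw [h3]
  calc |∑ k, V⁻¹ ⟨j, hj'⟩ k * V.mulVec cv k| ≤ ∑ k, |V⁻¹ ⟨j, hj'⟩ k * V.mulVec cv k| :=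
        Finset.abs_sum_le_sum_abs _ _
    _ ≤ ∑ k, |V⁻¹ ⟨j, hj'⟩ k| * M := by
        refine Finset.sum_le_sum fun k _ => ?_
        rw [abs_mul]
        exact mul_le_mul_of_nonneg_left (h2 k) (abs_nonneg _)
    _ = (∑ k, |V⁻¹ ⟨j, hj'⟩ k|) * M := by rw [Finset.sum_mul]
    _ ≤ _ := by
        refine mul_le_mul_of_nonneg_right ?_ hM0
        exact Finset.single_le_sum (f := fun j => ∑ k, |V⁻¹ j k|)
          (fun i _ => by positivity) (Finset.mem_univ (⟨j, hj'⟩ : Fin (n + 1)))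

/-- One-dimensional interpolation at an endpoint. -/
lemma interp_one_dim (n : ℕ) : ∃ K : ℝ, 0 ≤ K ∧ ∀ (g : ℕ → ℝ → ℝ) (h A H : ℝ), 0 ≤ h →
    (∀ j < n, ∀ s, HasDerivAt (g j) (g (j + 1) s) s) →
    (∀ s, 0 ≤ s → s ≤ h → |g 0 s| ≤ A) →
    (∀ s, 0 ≤ s → s ≤ h → |g n s - g n 0| ≤ H) →
    ∀ j ≤ n, |g j 0| * h ^ j ≤ K * (A + H * h ^ n) := by
  obtain ⟨K, hK0, hK⟩ := coeff_bound n
  refine ⟨n.factorial * K, by positivity, ?_⟩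
  intro g h A H hh hg hA hH j hj
  have hH0 : 0 ≤ H := (abs_nonneg _).trans (hH 0 le_rfl hh)
  have hA0 : 0 ≤ A := (abs_nonneg _).trans (hA 0 le_rfl hh)
  have key := hK (fun i => g i 0 * h ^ i / (i.factorial : ℝ)) (A + H * h ^ n) ?_ j hj
  · have hf : (0 : ℝ) < (j.factorial : ℝ) := by positivity
    rw [abs_div, abs_mul, abs_of_nonneg (pow_nonneg hh j), abs_of_pos hf, div_le_iff₀ hf] at key
    refine key.trans ?_
    have h1 : (j.factorial : ℝ) ≤ n.factorial := by exact_mod_cast Nat.factorial_le hj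
    have h2 : 0 ≤ K * (A + H * h ^ n) := by positivity
    nlinarith
  · intro y hy0 hy1
    have hyh : y * h ≤ h := by nlinarith
    have hyh0 : 0 ≤ y * h := by positivity
    have ht := taylor_chain n g h H hh hg hH (y * h) hyh0 hyh
    have ha := hA (y * h) hyh0 hyh
    have e : ∑ i ∈ Finset.range (n + 1), g i 0 * h ^ i / (i.factorial : ℝ) * y ^ i
        = ∑ i ∈ Finset.range (n + 1), g i 0 * (y * h) ^ i / (i.factorial : ℝ) := by
      refine Finset.sum_congr rfl fun i _ => ?_
      rw [mul_pow]; ring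
    rw [e]
    have hp : H * (y * h) ^ n ≤ H * h ^ n :=
      mul_le_mul_of_nonneg_left (pow_le_pow_left₀ hyh0 hyh n) hH0
    rw [abs_le] at *
    constructor <;> linarith [ha.1, ha.2, ht.1, ht.2]

/-- Directional derivatives commute with iterated derivatives. -/
lemma iteratedFDeriv_dir_comm {G : Type*} [NormedAddCommGroup G] [NormedSpace ℝ G]
    (W : G → ℝ) (hW : ContDiff ℝ (⊤ : ℕ∞) W) (e : G) (p : ℕ) :
    iteratedFDeriv ℝ p (fun z => fderiv ℝ W z e)
      = fun z => fderiv ℝ (iteratedFDeriv ℝ p W) z e := by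
  induction p with
  | zero =>
    ext z m
    have h0 : iteratedFDeriv ℝ 0 W
        = (continuousMultilinearCurryFin0 ℝ G ℝ).symm ∘ W := iteratedFDeriv_zero_eq_comp
    rw [h0, LinearIsometryEquiv.comp_fderiv]
    simp
  | succ p ih =>
    ext z m
    rw [iteratedFDeriv_succ_apply_left, ih]
    set F := iteratedFDeriv ℝ p W with hF
    have hFs : ContDiff ℝ (⊤ : ℕ∞) F := hW.iteratedFDeriv_right (by exact_mod_cast le_top)
    have hdF : ContDiff ℝ (⊤ : ℕ∞) (fderiv ℝ F) := hFs.fderiv_right (by simp)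
    have hd : DifferentiableAt ℝ (fderiv ℝ F) z := (hdF.differentiable (by simp)) z
    have h1 : fderiv ℝ (fun z => fderiv ℝ F z e) z (m 0) = fderiv ℝ (fderiv ℝ F) z (m 0) e := by
      rw [fderiv_clm_apply hd (differentiableAt_const e)]
      simp
    have hs : IsSymmSndFDerivAt ℝ F z :=
      hFs.contDiffAt.isSymmSndFDerivAt (by simp; exact WithTop.coe_le_coe.2 le_top)
    rw [h1, hs.eq]
    have hΦ : DifferentiableAt ℝ (iteratedFDeriv ℝ (p + 1) W) z :=
      (hW.differentiable_iteratedFDeriv (m := p + 1)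
        (by exact_mod_cast (ENat.natCast_lt_top (p + 1)))) z
    have h5 : HasFDerivAt (fun y => iteratedFDeriv ℝ (p + 1) W y m) _ z :=
      (ContinuousMultilinearMap.apply ℝ (fun _ : Fin (p + 1) => G) ℝ m).hasFDerivAt.comp z
        hΦ.hasFDerivAt
    have hd' : HasFDerivAt (fun y => fderiv ℝ F y (m 0)) _ z :=
      hd.hasFDerivAt.clm_apply (hasFDerivAt_const (m 0) z)
    have h6 : HasFDerivAt (fun y => iteratedFDeriv ℝ (p + 1) W y m) _ z :=
      (ContinuousMultilinearMap.apply ℝ (fun _ : Fin p => G) ℝ (Fin.tail m)).hasFDerivAt.comp z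
        hd'
    have h7 := congrArg (fun L => L e) (h5.unique h6)
    simpa using h7.symm

lemma timeDeriv_succ {E : Type*} [NormedAddCommGroup E] [NormedSpace ℝ E]
    (u : E × ℝ → ℝ) (hu : ContDiff ℝ (⊤ : ℕ∞) u) (q : ℕ) :
    ContDiff ℝ (⊤ : ℕ∞) (fun z : E × ℝ => iteratedDeriv q (fun τ => u (z.1, τ)) z.2) ∧
    ∀ z : E × ℝ, iteratedDeriv (q + 1) (fun τ => u (z.1, τ)) z.2
      = fderiv ℝ (fun z : E × ℝ => iteratedDeriv q (fun τ => u (z.1, τ)) z.2) z (0, 1) := by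
  have step : ∀ q, ContDiff ℝ (⊤ : ℕ∞)
      (fun z : E × ℝ => iteratedDeriv q (fun τ => u (z.1, τ)) z.2) →
      ∀ z : E × ℝ, iteratedDeriv (q + 1) (fun τ => u (z.1, τ)) z.2
      = fderiv ℝ (fun z : E × ℝ => iteratedDeriv q (fun τ => u (z.1, τ)) z.2) z (0, 1) := by
    intro q hq z
    rw [iteratedDeriv_succ]
    have h1 : HasFDerivAt (fun z : E × ℝ => iteratedDeriv q (fun τ => u (z.1, τ)) z.2)
      (fderiv ℝ (fun z : E × ℝ => iteratedDeriv q (fun τ => u (z.1, τ)) z.2) z) (z.1, z.2) :=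
      ((hq.differentiable (by simp)) z).hasFDerivAt
    have h2 : HasDerivAt (fun s : ℝ => ((z.1, s) : E × ℝ)) ((0 : E), (1 : ℝ)) z.2 :=
      (hasDerivAt_const _ _).prodMk (hasDerivAt_id _)
    exact (h1.comp_hasDerivAt z.2 h2).deriv
  have sm : ∀ q, ContDiff ℝ (⊤ : ℕ∞)
      (fun z : E × ℝ => iteratedDeriv q (fun τ => u (z.1, τ)) z.2) := by
    intro q
    induction q with
    | zero => simpa using hu
    | succ q ih =>
      have : (fun z : E × ℝ => iteratedDeriv (q + 1) (fun τ => u (z.1, τ)) z.2)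
        = fun z => fderiv ℝ (fun z : E × ℝ => iteratedDeriv q (fun τ => u (z.1, τ)) z.2) z (0, 1) :=
        funext (step q ih)
      rw [this]
      exact (ih.fderiv_right (by simp)).clm_apply contDiff_const
  exact ⟨sm q, step q (sm q)⟩

lemma slice_iteratedFDeriv {E : Type*} [NormedAddCommGroup E] [NormedSpace ℝ E]
    (W : E × ℝ → ℝ) (hW : ContDiff ℝ (⊤ : ℕ∞) W) (p : ℕ) (x : E) (s : ℝ) (m : Fin p → E) :
    iteratedFDeriv ℝ p (fun y => W (y, s)) x m
      = iteratedFDeriv ℝ p W (x, s) (fun i => (m i, 0)) := by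
  have h1 : (fun y => W (y, s))
      = (fun z => W (z + (0, s))) ∘ (ContinuousLinearMap.inl ℝ E ℝ) := by
    ext y; simp
  have h2 : ContDiff ℝ (⊤ : ℕ∞) (fun z : E × ℝ => W (z + (0, s))) :=
    hW.comp (contDiff_id.add contDiff_const)
  rw [h1, ContinuousLinearMap.iteratedFDeriv_comp_right _ h2 x (i := p) (by exact_mod_cast le_top),
    iteratedFDeriv_comp_add_right]
  simp

lemma hasDerivAt_time (d : ℕ) (u : EuclideanSpace ℝ (Fin d) × ℝ → ℝ)
    (hu : ContDiff ℝ (⊤ : ℕ∞) u) (p q : ℕ) (x : EuclideanSpace ℝ (Fin d)) (s : ℝ)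
    (m : Fin p → EuclideanSpace ℝ (Fin d)) :
    HasDerivAt (fun s => spaceTimeDeriv d u p q x s m) (spaceTimeDeriv d u p (q + 1) x s m) s := by
  obtain ⟨h1, h2⟩ := timeDeriv_succ u hu q
  obtain ⟨h1', -⟩ := timeDeriv_succ u hu (q + 1)
  set W := (fun z : EuclideanSpace ℝ (Fin d) × ℝ => iteratedDeriv q (fun τ => u (z.1, τ)) z.2)
    with hWdef
  have e1 : ∀ s, spaceTimeDeriv d u p q x s m
      = iteratedFDeriv ℝ p W (x, s) (fun i => (m i, 0)) := fun s =>
    slice_iteratedFDeriv W h1 p x s m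
  have e2 : spaceTimeDeriv d u p (q + 1) x s m
      = fderiv ℝ (iteratedFDeriv ℝ p W) (x, s) (0, 1) (fun i => (m i, 0)) := by
    have := slice_iteratedFDeriv _ h1' p x s m
    rw [show (fun z : EuclideanSpace ℝ (Fin d) × ℝ =>
      iteratedDeriv (q + 1) (fun τ => u (z.1, τ)) z.2) = fun z => fderiv ℝ W z (0, 1) from
      funext h2, iteratedFDeriv_dir_comm W h1] at this
    rw [← this]
    unfold spaceTimeDeriv
    congr 2
  simp only [e1]
  rw [e2]
  have hF : HasFDerivAt (iteratedFDeriv ℝ p W) (fderiv ℝ (iteratedFDeriv ℝ p W) (x, s)) (x, s) :=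
    ((h1.differentiable_iteratedFDeriv (m := p) (by exact_mod_cast (ENat.natCast_lt_top p)))
      (x, s)).hasFDerivAt
  have hl : HasDerivAt (fun s : ℝ => ((x, s) : EuclideanSpace ℝ (Fin d) × ℝ)) (0, 1) s :=
    (hasDerivAt_const _ _).prodMk (hasDerivAt_id _)
  have h3 := hF.comp_hasDerivAt s hl
  exact (ContinuousMultilinearMap.apply ℝ (fun _ : Fin p => EuclideanSpace ℝ (Fin d) × ℝ) ℝ
    (fun i => (m i, 0))).hasFDerivAt.comp_hasDerivAt s h3

lemma multilinear_norm_le_of_unit {E : Type*} [NormedAddCommGroup E] [NormedSpace ℝ E] {p : ℕ}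
    (f : ContinuousMultilinearMap ℝ (fun _ : Fin p => E) ℝ) (M : ℝ)
    (h : ∀ m : Fin p → E, (∀ i, ‖m i‖ ≤ 1) → |f m| ≤ M) : ‖f‖ ≤ M := by
  have hM : 0 ≤ M := (abs_nonneg _).trans (h 0 (by simp))
  refine ContinuousMultilinearMap.opNorm_le_bound hM fun m => ?_
  by_cases h0 : ∃ i, m i = 0
  · obtain ⟨i, hi⟩ := h0
    rw [f.map_coord_zero i hi]
    simp only [norm_zero]
    positivity
  · push Not at h0
    have hm : m = fun i => ‖m i‖ • (‖m i‖⁻¹ • m i) := by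
      funext i
      rw [smul_smul, mul_inv_cancel₀ (norm_ne_zero_iff.2 (h0 i)), one_smul]
    have h1 := h (fun i => ‖m i‖⁻¹ • m i) (fun i => by
      rw [norm_smul, norm_inv, norm_norm, inv_mul_cancel₀ (norm_ne_zero_iff.2 (h0 i))])
    have h2 : f m = (∏ i, ‖m i‖) • f (fun i => ‖m i‖⁻¹ • m i) := by
      conv_lhs => rw [hm]
      exact f.map_smul_univ _ _
    rw [h2, norm_smul, Real.norm_eq_abs, Real.norm_eq_abs,
      abs_of_nonneg (Finset.prod_nonneg fun i _ => norm_nonneg _), mul_comm]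
    exact mul_le_mul_of_nonneg_right h1 (Finset.prod_nonneg fun i _ => norm_nonneg _)

lemma multilinear_unit_le {E : Type*} [NormedAddCommGroup E] [NormedSpace ℝ E] {p : ℕ}
    (f : ContinuousMultilinearMap ℝ (fun _ : Fin p => E) ℝ)
    (m : Fin p → E) (hm : ∀ i, ‖m i‖ ≤ 1) : |f m| ≤ ‖f‖ :=
  f.unit_le_opNorm ((pi_norm_le_iff_of_nonneg zero_le_one).2 hm)

/-- Prepend `j` copies of `v` to `m`. -/
def prependVec {E : Type*} {p : ℕ} (v : E) (m : Fin p → E) : (j : ℕ) → Fin (p + j) → E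
  | 0 => m
  | j + 1 => Fin.cons (α := fun _ => E) v (prependVec v m j)

lemma prependVec_norm {E : Type*} [NormedAddCommGroup E] {p : ℕ} (v : E) (m : Fin p → E)
    (hv : ‖v‖ ≤ 1) (hm : ∀ i, ‖m i‖ ≤ 1) (j : ℕ) : ∀ i, ‖prependVec v m j i‖ ≤ 1 := by
  induction j with
  | zero => exact hm
  | succ j ih =>
    intro i
    refine Fin.cases ?_ (fun i => ?_) i
    · exact hv
    · exact ih i

lemma space_step (n : ℕ) (hn : 1 ≤ n) : ∃ K : ℝ, 0 ≤ K ∧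
    ∀ {E : Type} [NormedAddCommGroup E] [NormedSpace ℝ E] (w : E → ℝ)
      (_ : ContDiff ℝ (⊤ : ℕ∞) w) (p : ℕ) (x : E) (r A H : ℝ), 0 ≤ r →
      (∀ y, ‖y - x‖ ≤ r → ‖iteratedFDeriv ℝ p w y‖ ≤ A) →
      (∀ y, ‖y - x‖ ≤ r → ‖iteratedFDeriv ℝ (p + n) w y - iteratedFDeriv ℝ (p + n) w x‖ ≤ H) →
      ‖iteratedFDeriv ℝ (p + 1) w x‖ * r ≤ K * (A + H * r ^ n) := by
  obtain ⟨K, hK0, hK⟩ := interp_one_dim n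
  refine ⟨K, hK0, ?_⟩
  intro E _ _ w hw p x r A H hr hA hH
  rcases hr.eq_or_lt with hr0 | hrpos
  · have hA0 : 0 ≤ A := (norm_nonneg _).trans (hA x (by simpa using hr))
    have hH0 : 0 ≤ H := (norm_nonneg _).trans (hH x (by simpa using hr))
    rw [← hr0]
    have : (0 : ℝ) ≤ 0 ^ n := by positivity
    rw [mul_zero]; positivity
  rw [← le_div_iff₀ hrpos]
  refine multilinear_norm_le_of_unit _ _ fun m hm => ?_
  rw [le_div_iff₀ hrpos]
  set v := m 0
  set g : ℕ → ℝ → ℝ := fun j σ =>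
    iteratedFDeriv ℝ (p + j) w (x + σ • v) (prependVec v (Fin.tail m) j) with hg
  have hline : ∀ σ : ℝ, HasDerivAt (fun σ : ℝ => x + σ • v) v σ := by
    intro σ
    simpa using ((hasDerivAt_id σ).smul_const v).const_add x
  have hdist : ∀ s, 0 ≤ s → s ≤ r → ‖x + s • v - x‖ ≤ r := by
    intro s hs hsr
    rw [add_sub_cancel_left, norm_smul, Real.norm_eq_abs, abs_of_nonneg hs]
    have := hm 0
    have h0 : ‖v‖ ≤ 1 := this
    nlinarith [norm_nonneg v]
  have hun : ∀ j i, ‖prependVec v (Fin.tail m) j i‖ ≤ 1 :=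
    prependVec_norm v _ (hm 0) (fun i => hm i.succ)
  have key := hK g r A H hr ?_ ?_ ?_ 1 hn
  · rw [pow_one] at key
    have e : g 1 0 = iteratedFDeriv ℝ (p + 1) w x m := by
      have e1 : prependVec v (Fin.tail m) 1 = m := Fin.cons_self_tail m
      have e2 : x + (0 : ℝ) • v = x := by rw [zero_smul, add_zero]
      change iteratedFDeriv ℝ (p + 1) w (x + (0 : ℝ) • v) (prependVec v (Fin.tail m) 1) = _
      rw [e1, e2]
    rwa [e] at key
  · intro j hj s
    have hF : HasFDerivAt (iteratedFDeriv ℝ (p + j) w)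
        (fderiv ℝ (iteratedFDeriv ℝ (p + j) w) (x + s • v)) (x + s • v) :=
      ((hw.differentiable_iteratedFDeriv (m := p + j)
        (by exact_mod_cast (ENat.natCast_lt_top (p + j)))) _).hasFDerivAt
    have h3 := hF.comp_hasDerivAt s (hline s)
    exact (ContinuousMultilinearMap.apply ℝ (fun _ : Fin (p + j) => E) ℝ
      (prependVec v (Fin.tail m) j)).hasFDerivAt.comp_hasDerivAt s h3
  · intro s hs hsr
    exact (multilinear_unit_le _ _ (hun 0)).trans (hA _ (hdist s hs hsr))
  · intro s hs hsr
    have := (multilinear_unit_le (iteratedFDeriv ℝ (p + n) w (x + s • v)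
      - iteratedFDeriv ℝ (p + n) w x) _ (hun n)).trans (hH _ (hdist s hs hsr))
    simpa [hg] using this

lemma time_step (n : ℕ) : ∃ K : ℝ, 0 ≤ K ∧
    ∀ (d : ℕ) (u : EuclideanSpace ℝ (Fin d) × ℝ → ℝ) (_ : ContDiff ℝ (⊤ : ℕ∞) u) (p : ℕ)
      (x : EuclideanSpace ℝ (Fin d)) (s ε h A H : ℝ), (ε = 1 ∨ ε = -1) → 0 < h →
      (∀ σ, 0 ≤ σ → σ ≤ h → ‖spaceTimeDeriv d u p 0 x (s + ε * σ)‖ ≤ A) →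
      (∀ σ, 0 ≤ σ → σ ≤ h →
        ‖spaceTimeDeriv d u p n x (s + ε * σ) - spaceTimeDeriv d u p n x s‖ ≤ H) →
      ∀ q ≤ n, ‖spaceTimeDeriv d u p q x s‖ * h ^ q ≤ K * (A + H * h ^ n) := by
  obtain ⟨K, hK0, hK⟩ := interp_one_dim n
  refine ⟨K, hK0, ?_⟩
  intro d u hu p x s ε h A H hε hh hA hH q hq
  have hεa : ∀ j : ℕ, |ε ^ j| = 1 := by
    intro j
    rw [abs_pow]
    rcases hε with h | h <;> simp [h]
  have hhq : 0 < h ^ q := by positivity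
  rw [← le_div_iff₀ hhq]
  refine multilinear_norm_le_of_unit _ _ fun m hm => ?_
  rw [le_div_iff₀ hhq]
  set g : ℕ → ℝ → ℝ := fun j σ => ε ^ j * spaceTimeDeriv d u p j x (s + ε * σ) m with hg
  have key := hK g h A H hh.le ?_ ?_ ?_ q hq
  · simpa [hg, abs_mul, hεa] using key
  · intro j hj σ
    have h1 : HasDerivAt (fun σ : ℝ => s + ε * σ) ε σ := by
      simpa using ((hasDerivAt_id σ).const_mul ε).const_add s
    have h2 := ((hasDerivAt_time d u hu p j x (s + ε * σ) m).comp σ h1).const_mul (ε ^ j)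
    refine h2.congr_deriv ?_
    simp only [hg]
    ring
  · intro σ hσ hσh
    simp only [hg, pow_zero, one_mul]
    exact (multilinear_unit_le _ _ hm).trans (hA σ hσ hσh)
  · intro σ hσ hσh
    have := (multilinear_unit_le (spaceTimeDeriv d u p n x (s + ε * σ)
      - spaceTimeDeriv d u p n x s) _ hm).trans (hH σ hσ hσh)
    simp only [hg, mul_zero, add_zero]
    rw [← mul_sub, abs_mul, hεa, one_mul]
    simpa using this

/-- Uniform componentwise form of the Hölder bound. -/
def HolBd (d : ℕ) (u : EuclideanSpace ℝ (Fin d) × ℝ → ℝ) (m : ℕ) (α ρ t B : ℝ) : Prop :=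
  ∀ p q : ℕ, p + 2 * q = m → ∀ z ∈ parabolicCylinder d ρ t, ∀ w ∈ parabolicCylinder d ρ t,
    ‖spaceTimeDeriv d u p q z.1 z.2 - spaceTimeDeriv d u p q w.1 w.2‖
      ≤ B * parabolicDist d z w ^ α

/-- Scaled bound for one component on a cylinder. -/
def CompBd (d : ℕ) (u : EuclideanSpace ℝ (Fin d) × ℝ → ℝ) (R t r : ℝ) (p q : ℕ) (M : ℝ) : Prop :=
  ∀ x, ‖x‖ ≤ R → ∀ s, t - 1 ≤ s → s ≤ t → r ^ (p + 2 * q) * ‖spaceTimeDeriv d u p q x s‖ ≤ M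

lemma parabolicDist_nonneg (d : ℕ) (z w : EuclideanSpace ℝ (Fin d) × ℝ) :
    0 ≤ parabolicDist d z w := by
  unfold parabolicDist; positivity

lemma holBd_of (d : ℕ) (u : EuclideanSpace ℝ (Fin d) × ℝ → ℝ) (m : ℕ) (α ρ t B : ℝ)
    (h : frakDHolderLE d u m α (parabolicCylinder d ρ t) B) : 0 ≤ B ∧ HolBd d u m α ρ t B := by
  obtain ⟨M, hM0, hMB, hM⟩ := h
  refine ⟨(Finset.sum_nonneg fun q _ => hM0 q).trans hMB, ?_⟩
  intro p q hpq z hz w hw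
  have hq : q ∈ Finset.range (m / 2 + 1) := by
    rw [Finset.mem_range]; omega
  have hp : m - 2 * q = p := by omega
  have h1 := hM q hq z hz w hw
  rw [hp] at h1
  refine h1.trans (mul_le_mul_of_nonneg_right ?_ (Real.rpow_nonneg (parabolicDist_nonneg _ _ _) _))
  exact (Finset.single_le_sum (fun i _ => hM0 i) hq).trans hMB

lemma space_bd (m p q : ℕ) (hpq : p + 1 + 2 * q ≤ m) : ∃ K : ℝ, 0 ≤ K ∧
    ∀ (d : ℕ) (u : EuclideanSpace ℝ (Fin d) × ℝ → ℝ) (_ : ContDiff ℝ (⊤ : ℕ∞) u)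
      (α ρ R t r B M : ℝ), 0 < α → 0 ≤ B → HolBd d u m α ρ t B → 0 < r → R + r ≤ ρ →
      CompBd d u (R + r) t r p q M → CompBd d u R t r (p + 1) q (K * (M + B * r ^ α * r ^ m)) := by
  obtain ⟨n, rfl⟩ : ∃ n, m = p + n + 2 * q := ⟨m - p - 2 * q, by omega⟩
  obtain ⟨K, hK0, hK⟩ := space_step n (by omega)
  refine ⟨K, hK0, ?_⟩
  intro d u hu α ρ R t r B M hα hB hol hr hR hM x hx s hs1 hs2
  have hw : ContDiff ℝ (⊤ : ℕ∞)
      (fun y : EuclideanSpace ℝ (Fin d) => iteratedDeriv q (fun τ => u (y, τ)) s) :=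
    (timeDeriv_succ u hu q).1.comp (contDiff_id.prodMk contDiff_const)
  have hball : ∀ y, ‖y - x‖ ≤ r → ‖y‖ ≤ R + r := by
    intro y hy
    have : ‖y‖ ≤ ‖x‖ + ‖y - x‖ := by
      simpa using norm_add_le x (y - x)
    linarith
  have hrp : 0 < r ^ (p + 2 * q) := by positivity
  have key := hK (fun y : EuclideanSpace ℝ (Fin d) => iteratedDeriv q (fun τ => u (y, τ)) s) hw p x
    r (M / r ^ (p + 2 * q)) (B * r ^ α) hr.le ?_ ?_
  · calc r ^ (p + 1 + 2 * q) * ‖spaceTimeDeriv d u (p + 1) q x s‖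
        = r ^ (p + 2 * q) * (‖spaceTimeDeriv d u (p + 1) q x s‖ * r) := by ring
      _ ≤ r ^ (p + 2 * q) * (K * (M / r ^ (p + 2 * q) + B * r ^ α * r ^ n)) :=
          mul_le_mul_of_nonneg_left key hrp.le
      _ = K * (M + B * r ^ α * r ^ (p + n + 2 * q)) := by
          rw [show p + n + 2 * q = (p + 2 * q) + n by ring, pow_add r (p + 2 * q) n]
          field_simp
  · intro y hy
    rw [le_div_iff₀ hrp, mul_comm]
    exact hM y (hball y hy) s hs1 hs2
  · intro y hy
    have h1 := hol (p + n) q rfl (y, s) ⟨(hball y hy).trans hR, hs1, hs2⟩ (x, s)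
      ⟨by simp only; linarith, hs1, hs2⟩
    refine h1.trans (mul_le_mul_of_nonneg_left ?_ hB)
    refine Real.rpow_le_rpow (parabolicDist_nonneg _ _ _) ?_ hα.le
    simp only [parabolicDist, sub_self, abs_zero]
    rw [Real.zero_rpow (by norm_num), add_zero]
    exact hy

lemma time_bd (m p n : ℕ) (hpn : p + 2 * n = m) : ∃ K : ℝ, 0 ≤ K ∧
    ∀ (d : ℕ) (u : EuclideanSpace ℝ (Fin d) × ℝ → ℝ) (_ : ContDiff ℝ (⊤ : ℕ∞) u)
      (α ρ R t r B M : ℝ), 0 < α → 0 ≤ B → HolBd d u m α ρ t B → 0 < r → r ^ 2 ≤ 1 / 2 → R ≤ ρ →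
      CompBd d u R t r p 0 M →
      ∀ q ≤ n, CompBd d u R t r p q (K * (M + B * r ^ α * r ^ m)) := by
  subst hpn
  obtain ⟨K, hK0, hK⟩ := time_step n
  refine ⟨K, hK0, ?_⟩
  intro d u hu α ρ R t r B M hα hB hol hr hr2 hR hM q hq x hx s hs1 hs2
  obtain ⟨ε, hε, hin⟩ : ∃ ε : ℝ, (ε = 1 ∨ ε = -1) ∧
      ∀ σ, 0 ≤ σ → σ ≤ r ^ 2 → t - 1 ≤ s + ε * σ ∧ s + ε * σ ≤ t := by
    by_cases h : s ≤ t - 1 / 2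
    · exact ⟨1, Or.inl rfl, fun σ h1 h2 => ⟨by linarith, by linarith⟩⟩
    · exact ⟨-1, Or.inr rfl, fun σ h1 h2 => ⟨by linarith, by linarith⟩⟩
  have hrp : 0 < r ^ p := by positivity
  have key := hK d u hu p x s ε (r ^ 2) (M / r ^ p) (B * r ^ α) hε (by positivity) ?_ ?_ q hq
  · calc r ^ (p + 2 * q) * ‖spaceTimeDeriv d u p q x s‖
        = r ^ p * (‖spaceTimeDeriv d u p q x s‖ * (r ^ 2) ^ q) := by
          rw [pow_add, pow_mul]; ring
      _ ≤ r ^ p * (K * (M / r ^ p + B * r ^ α * (r ^ 2) ^ n)) :=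
          mul_le_mul_of_nonneg_left key hrp.le
      _ = K * (M + B * r ^ α * r ^ (p + 2 * n)) := by
          rw [pow_add, pow_mul]
          field_simp
  · intro σ h1 h2
    rw [le_div_iff₀ hrp, mul_comm]
    have := hM x hx (s + ε * σ) (hin σ h1 h2).1 (hin σ h1 h2).2
    simpa using this
  · intro σ h1 h2
    have h3 := hol p n rfl (x, s + ε * σ) ⟨hx.trans hR, (hin σ h1 h2).1, (hin σ h1 h2).2⟩ (x, s)
      ⟨hx.trans hR, hs1, hs2⟩
    refine h3.trans (mul_le_mul_of_nonneg_left ?_ hB)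
    refine Real.rpow_le_rpow (parabolicDist_nonneg _ _ _) ?_ hα.le
    have hσ : |ε * σ| ≤ r ^ 2 := by
      rw [abs_mul, abs_of_nonneg h1]
      rcases hε with h | h <;> simpa [h] using h2
    simp only [parabolicDist, sub_self, norm_zero, zero_add, add_sub_cancel_left]
    rw [← Real.sqrt_eq_rpow]
    exact (Real.sqrt_le_left hr.le).2 hσ

/-- Pure space derivatives. -/
lemma space_all (m p : ℕ) (hp : p ≤ m) : ∃ K : ℝ, 0 ≤ K ∧
    ∀ (d : ℕ) (u : EuclideanSpace ℝ (Fin d) × ℝ → ℝ) (_ : ContDiff ℝ (⊤ : ℕ∞) u)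
      (α ρ R t r A B : ℝ), 0 < α → 0 ≤ A → 0 ≤ B → HolBd d u m α ρ t B → 0 < r →
      (∀ z ∈ parabolicCylinder d ρ t, |u z| ≤ A) → R + p * r ≤ ρ →
      CompBd d u R t r p 0 (K * (A + B * r ^ α * r ^ m)) := by
  induction p with
  | zero =>
    refine ⟨1, zero_le_one, ?_⟩
    intro d u hu α ρ R t r A B hα hA hB hol hr hu' hR x hx s hs1 hs2
    have h1 : ‖spaceTimeDeriv d u 0 0 x s‖ = |u (x, s)| := by
      simp [spaceTimeDeriv]
    have h2 := hu' (x, s) ⟨by simp at hR; exact hx.trans hR, hs1, hs2⟩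
    have h3 : 0 ≤ B * r ^ α * r ^ m := by positivity
    simp only [mul_zero, add_zero, pow_zero, one_mul, h1]
    linarith
  | succ p ih =>
    obtain ⟨K, hK0, hK⟩ := ih (by omega)
    obtain ⟨K', hK'0, hK'⟩ := space_bd m p 0 (by omega)
    refine ⟨K' * (K + 1), by positivity, ?_⟩
    intro d u hu α ρ R t r A B hα hA hB hol hr hu' hR x hx s hs1 hs2
    push_cast at hR
    have hpr : 0 ≤ p * r := by positivity
    have h1 := hK d u hu α ρ (R + r) t r A B hα hA hB hol hr hu' (by linarith)
    have h2 := hK' d u hu α ρ R t r B _ hα hB hol hr (by linarith) h1 x hx s hs1 hs2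
    refine h2.trans ?_
    rw [mul_assoc K' (K + 1)]
    refine mul_le_mul_of_nonneg_left ?_ hK'0
    linarith

lemma interp_all (m p q : ℕ) (hpq : p + 2 * q ≤ m) (hm : p + 2 * q = m ∨ Even m) :
    ∃ K : ℝ, 0 ≤ K ∧
    ∀ (d : ℕ) (u : EuclideanSpace ℝ (Fin d) × ℝ → ℝ) (_ : ContDiff ℝ (⊤ : ℕ∞) u)
      (α ρ R t r A B : ℝ), 0 < α → 0 ≤ A → 0 ≤ B → HolBd d u m α ρ t B → 0 < r → r ^ 2 ≤ 1 / 2 →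
      (∀ z ∈ parabolicCylinder d ρ t, |u z| ≤ A) → R + m * r ≤ ρ →
      CompBd d u R t r p q (K * (A + B * r ^ α * r ^ m)) := by
  have base : ∀ p n, p + 2 * n = m → ∃ K : ℝ, 0 ≤ K ∧
      ∀ (d : ℕ) (u : EuclideanSpace ℝ (Fin d) × ℝ → ℝ) (_ : ContDiff ℝ (⊤ : ℕ∞) u)
      (α ρ R t r A B : ℝ), 0 < α → 0 ≤ A → 0 ≤ B → HolBd d u m α ρ t B → 0 < r → r ^ 2 ≤ 1 / 2 →
      (∀ z ∈ parabolicCylinder d ρ t, |u z| ≤ A) → R + p * r ≤ ρ →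
      ∀ q ≤ n, CompBd d u R t r p q (K * (A + B * r ^ α * r ^ m)) := by
    intro p n hpn
    obtain ⟨K, hK0, hK⟩ := space_all m p (by omega)
    obtain ⟨K', hK'0, hK'⟩ := time_bd m p n hpn
    refine ⟨K' * (K + 1), by positivity, ?_⟩
    intro d u hu α ρ R t r A B hα hA hB hol hr hr2 hu' hR q hq x hx s hs1 hs2
    have hpr : 0 ≤ p * r := by positivity
    have h1 := hK d u hu α ρ R t r A B hα hA hB hol hr hu' hR
    have h2 := hK' d u hu α ρ R t r B _ hα hB hol hr hr2 (by linarith) h1 q hq x hx s hs1 hs2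
    refine h2.trans ?_
    rw [mul_assoc K' (K + 1)]
    refine mul_le_mul_of_nonneg_left ?_ hK'0
    linarith
  by_cases hpar : Even (m - p)
  · obtain ⟨n, hn⟩ := hpar
    obtain ⟨K, hK0, hK⟩ := base p n (by omega)
    refine ⟨K, hK0, ?_⟩
    intro d u hu α ρ R t r A B hα hA hB hol hr hr2 hu' hR
    refine hK d u hu α ρ R t r A B hα hA hB hol hr hr2 hu' ?_ q (by omega)
    have : (p : ℝ) ≤ m := by exact_mod_cast (by omega : p ≤ m)
    nlinarith
  · have hme : Even m := by
      rcases hm with h | h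
      · exact absurd ⟨q, by omega⟩ hpar
      · exact h
    obtain ⟨p', rfl⟩ : ∃ p', p = p' + 1 := by
      cases p with
      | zero => exact absurd (by simpa using hme) hpar
      | succ p' => exact ⟨p', rfl⟩
    obtain ⟨n, hn⟩ : Even (m - p') := by
      rw [Nat.not_even_iff_odd] at hpar
      obtain ⟨c, hc⟩ := hpar
      exact ⟨c + 1, by omega⟩
    obtain ⟨K, hK0, hK⟩ := base p' n (by omega)
    obtain ⟨K', hK'0, hK'⟩ := space_bd m p' q (by omega)
    refine ⟨K' * (K + 1), by positivity, ?_⟩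
    intro d u hu α ρ R t r A B hα hA hB hol hr hr2 hu' hR x hx s hs1 hs2
    have hpm : (p' : ℝ) + 1 ≤ m := by exact_mod_cast (by omega : p' + 1 ≤ m)
    have hpr : 0 ≤ p' * r := by positivity
    have h1 := hK d u hu α ρ (R + r) t r A B hα hA hB hol hr hr2 hu' (by nlinarith) q (by omega)
    have h2 := hK' d u hu α ρ R t r B _ hα hB hol hr (by nlinarith) h1 x hx s hs1 hs2
    refine h2.trans ?_
    rw [mul_assoc K' (K + 1)]
    refine mul_le_mul_of_nonneg_left ?_ hK'0
    linarith

lemma frakD_interp (m ℓ : ℕ) (hℓ : ℓ ≤ m) (hm : ℓ = m ∨ Even m) :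
    ∃ K : ℝ, 0 ≤ K ∧
    ∀ (d : ℕ) (u : EuclideanSpace ℝ (Fin d) × ℝ → ℝ) (_ : ContDiff ℝ (⊤ : ℕ∞) u)
      (α ρ R t r A B : ℝ), 0 < α → 0 ≤ A → 0 ≤ B → HolBd d u m α ρ t B → 0 < r → r ^ 2 ≤ 1 / 2 →
      (∀ z ∈ parabolicCylinder d ρ t, |u z| ≤ A) → R + m * r ≤ ρ →
      ∀ z ∈ parabolicCylinder d R t,
      r ^ ℓ * frakDNorm d u ℓ z ≤ K * (A + B * r ^ α * r ^ m) := by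
  have h : ∀ q : ℕ, ∃ K : ℝ, 0 ≤ K ∧ (q ∈ Finset.range (ℓ / 2 + 1) →
    ∀ (d : ℕ) (u : EuclideanSpace ℝ (Fin d) × ℝ → ℝ) (_ : ContDiff ℝ (⊤ : ℕ∞) u)
      (α ρ R t r A B : ℝ), 0 < α → 0 ≤ A → 0 ≤ B → HolBd d u m α ρ t B → 0 < r → r ^ 2 ≤ 1 / 2 →
      (∀ z ∈ parabolicCylinder d ρ t, |u z| ≤ A) → R + m * r ≤ ρ →
      CompBd d u R t r (ℓ - 2 * q) q (K * (A + B * r ^ α * r ^ m))) := by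
    intro q
    by_cases hq : q ∈ Finset.range (ℓ / 2 + 1)
    · have hq' := Finset.mem_range.1 hq
      obtain ⟨K, hK0, hK⟩ := interp_all m (ℓ - 2 * q) q (by omega)
        (by rcases hm with h | h
            · left; omega
            · right; exact h)
      exact ⟨K, hK0, fun _ => hK⟩
    · exact ⟨0, le_rfl, fun h => absurd h hq⟩
  choose K hK0 hK using h
  refine ⟨∑ q ∈ Finset.range (ℓ / 2 + 1), K q, Finset.sum_nonneg fun q _ => hK0 q, ?_⟩
  intro d u hu α ρ R t r A B hα hA hB hol hr hr2 hu' hR z hz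
  have h1 : frakDNorm d u ℓ z ≤ ∑ q ∈ Finset.range (ℓ / 2 + 1),
      ‖spaceTimeDeriv d u (ℓ - 2 * q) q z.1 z.2‖ := by
    unfold frakDNorm
    refine (Real.sqrt_le_left (Finset.sum_nonneg fun q _ => norm_nonneg _)).2 ?_
    exact Finset.sum_sq_le_sq_sum_of_nonneg fun q _ => norm_nonneg _
  refine (mul_le_mul_of_nonneg_left h1 (by positivity)).trans ?_
  rw [Finset.mul_sum, Finset.sum_mul]
  refine Finset.sum_le_sum fun q hq => ?_
  have h2 := hK q hq d u hu α ρ R t r A B hα hA hB hol hr hr2 hu' hR z.1 hz.1 z.2 hz.2.1 hz.2.2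
  have hq' := Finset.mem_range.1 hq
  rwa [show ℓ - 2 * q + 2 * q = ℓ by omega] at h2

/-- The interpolation estimate at the optimal scale. -/
lemma main_scaled (m ℓ : ℕ) (hm8 : 8 ≤ m) (hℓ : ℓ ≤ m) (hpar : ℓ = m ∨ Even m)
    (d : ℕ) (u : EuclideanSpace ℝ (Fin d) × ℝ → ℝ) (hu : ContDiff ℝ (⊤ : ℕ∞) u)
    (α ρ ρ' β C₀ : ℝ) (hα : 0 < α) (hβ : 0 < β) (hC₀ : 0 < C₀) (hρ : ρ' < ρ)
    (h1 : ∀ t ≥ (1 : ℝ), ∀ z ∈ parabolicCylinder d ρ t,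
      |u z| ≤ C₀ * Real.exp (-(t / 2) * (4 + β)))
    (h3 : ∀ t ≥ (1 : ℝ), frakDHolderLE d u m α (parabolicCylinder d ρ t)
        (C₀ * Real.exp (((m : ℝ) - 10) * t / 2))) :
    ∃ C : ℝ, 0 ≤ C ∧ ∀ t ≥ (1 : ℝ), ∀ z ∈ parabolicCylinder d ρ' t, frakDNorm d u ℓ z ≤
        C * Real.exp (-(t / 2) * (4 + β - (ℓ : ℝ) * (((m : ℝ) - 6 + β) / ((m : ℝ) + α)))) := by
  obtain ⟨K, hK0, hK⟩ := frakD_interp m ℓ hℓ hpar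
  have hm8' : (8 : ℝ) ≤ m := by exact_mod_cast hm8
  set γ : ℝ := ((m : ℝ) - 6 + β) / ((m : ℝ) + α) with hγ
  have hγ0 : 0 ≤ γ := div_nonneg (by linarith) (by linarith)
  have hγm : γ * ((m : ℝ) + α) = (m : ℝ) - 6 + β := by
    rw [hγ]; exact div_mul_cancel₀ _ (by linarith)
  set r₀ : ℝ := min (1 / 2) ((ρ - ρ') / m) with hr₀
  have hr₀pos : 0 < r₀ := lt_min (by norm_num) (div_pos (by linarith) (by linarith))
  have hr₀half : r₀ ≤ 1 / 2 := min_le_left _ _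
  have hr₀m : m * r₀ ≤ ρ - ρ' := by
    have : r₀ ≤ (ρ - ρ') / m := min_le_right _ _
    rwa [le_div_iff₀ (by linarith), mul_comm] at this
  refine ⟨K * (2 * C₀) / r₀ ^ ℓ, by positivity, ?_⟩
  intro t ht z hz
  obtain ⟨hB0, hol⟩ := holBd_of d u m α ρ t _ (h3 t ht)
  set E : ℝ := Real.exp (-(t / 2) * γ) with hE
  have hEpos : 0 < E := Real.exp_pos _
  have hE1 : E ≤ 1 := Real.exp_le_one_iff.2 (by nlinarith)
  have hr : 0 < r₀ * E := by positivity
  have hrr : r₀ * E ≤ r₀ := by nlinarith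
  have key := hK d u hu α ρ ρ' t (r₀ * E) (C₀ * Real.exp (-(t / 2) * (4 + β)))
    (C₀ * Real.exp (((m : ℝ) - 10) * t / 2)) hα (by positivity) hB0 hol hr (by nlinarith)
    (h1 t ht) (by nlinarith) z hz
  have e1 : Real.exp (((m : ℝ) - 10) * t / 2) * (E ^ α * E ^ m)
      = Real.exp (-(t / 2) * (4 + β)) := by
    rw [hE, ← Real.exp_mul, ← Real.exp_nat_mul, ← Real.exp_add, ← Real.exp_add]
    congr 1
    linear_combination (-(t / 2)) * hγm
  have e2 : C₀ * Real.exp (((m : ℝ) - 10) * t / 2) * (r₀ * E) ^ α * (r₀ * E) ^ m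
      ≤ C₀ * Real.exp (-(t / 2) * (4 + β)) := by
    rw [Real.mul_rpow hr₀pos.le hEpos.le, mul_pow, ← e1]
    have a1 : r₀ ^ α ≤ 1 := Real.rpow_le_one hr₀pos.le (by linarith) hα.le
    have a2 : r₀ ^ m ≤ 1 := pow_le_one₀ hr₀pos.le (by linarith)
    have a3 : r₀ ^ α * r₀ ^ m ≤ 1 := mul_le_one₀ a1 (by positivity) a2
    have a4 : 0 ≤ C₀ * (Real.exp (((m : ℝ) - 10) * t / 2) * (E ^ α * E ^ m)) := by positivity
    calc _ = (C₀ * (Real.exp (((m : ℝ) - 10) * t / 2) * (E ^ α * E ^ m))) * (r₀ ^ α * r₀ ^ m) := by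
          ring
      _ ≤ _ := mul_le_of_le_one_right a4 a3
  have e3 : (r₀ * E) ^ ℓ * frakDNorm d u ℓ z
      ≤ K * (2 * C₀) * Real.exp (-(t / 2) * (4 + β)) := by
    refine key.trans ?_
    rw [mul_assoc K]
    refine mul_le_mul_of_nonneg_left ?_ hK0
    linarith
  have e4 : Real.exp (-(t / 2) * (4 + β))
      = E ^ ℓ * Real.exp (-(t / 2) * (4 + β - (ℓ : ℝ) * γ)) := by
    rw [hE, ← Real.exp_nat_mul, ← Real.exp_add]
    congr 1
    ring
  have hrl : 0 < (r₀ * E) ^ ℓ := by positivity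
  refine le_of_mul_le_mul_left (e3.trans_eq ?_) hrl
  rw [e4, mul_pow]
  field_simp

/-- Higher-order interpolation estimate with improved decay exponent
(estimate (5.11), part of Lemma 5.6 of the paper, in conditional form). -/
theorem higher_order_interp_estimate_improved
    (d : ℕ) (hd : 1 ≤ d) (ρ ρ' : ℝ) (hρ' : 0 < ρ') (hρ : ρ' < ρ)
    (α : ℝ) (hα0 : 4 / 5 < α) (hα1 : α < 1) (k : ℕ) (hk : 10 ≤ k) (C₀ : ℝ) (hC₀ : 0 < C₀)
    (u : EuclideanSpace ℝ (Fin d) × ℝ → ℝ) (hu : ContDiff ℝ (⊤ : ℕ∞) u)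
    (h1 : ∀ t ≥ (1 : ℝ), ∀ z ∈ parabolicCylinder d ρ t, |u z| ≤ C₀ * Real.exp (-(4 + α) * (1 - 2 / (12 + α)) * t / 2))
    (h2 : ∀ t ≥ (1 : ℝ), frakDHolderLE d u 8 α (parabolicCylinder d ρ t) (C₀ * Real.exp (-t)))
    (h3 : ∀ t ≥ (1 : ℝ), ∀ ℓ : ℕ, 8 ≤ ℓ → ℓ ≤ 2 * k + 10 →
      frakDHolderLE d u ℓ α (parabolicCylinder d ρ t)
        (C₀ * Real.exp (((ℓ : ℝ) - 10) * t / 2))) :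
    ∃ β, 0 < β ∧ β < α ∧ ∃ C > 0, ∀ t ≥ (1 : ℝ),
      (∀ ℓ : ℕ, ℓ ≤ 8 → ∀ z ∈ parabolicCylinder d ρ' t,
        frakDNorm d u ℓ z ≤
          C * Real.exp (-(t / 2) * (4 + β - (2 + β) * (ℓ : ℝ) / (8 + α)))) ∧
      (∀ ℓ : ℕ, 8 ≤ ℓ → ℓ ≤ 2 * k + 10 → ∀ z ∈ parabolicCylinder d ρ' t,
        frakDNorm d u ℓ z ≤
          C * Real.exp (-(t / 2) * (4 - ((ℓ : ℝ) * ((ℓ : ℝ) - 6) - α * β) / ((ℓ : ℝ) + α)))) := by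
  set β : ℝ := (4 + α) * (1 - 2 / (12 + α)) - 4 with hβ
  have h12 : 0 < 12 + α := by linarith
  have hβ' : β = (α ^ 2 + 10 * α - 8) / (12 + α) := by
    rw [hβ]; field_simp; ring
  have hβ0 : 0 < β := by
    rw [hβ']; exact div_pos (by nlinarith) h12
  have hβα : β < α := by
    rw [hβ', div_lt_iff₀ h12]; nlinarith
  have hmain : ∀ m ℓ : ℕ, ∃ C : ℝ, 0 ≤ C ∧ (8 ≤ m → m ≤ 2 * k + 10 → ℓ ≤ m → (ℓ = m ∨ Even m) →
      ∀ t ≥ (1 : ℝ), ∀ z ∈ parabolicCylinder d ρ' t, frakDNorm d u ℓ z ≤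
        C * Real.exp (-(t / 2) * (4 + β - (ℓ : ℝ) * (((m : ℝ) - 6 + β) / ((m : ℝ) + α))))) := by
    intro m ℓ
    by_cases hc : 8 ≤ m ∧ m ≤ 2 * k + 10 ∧ ℓ ≤ m ∧ (ℓ = m ∨ Even m)
    · obtain ⟨hm8, hmk, hℓm, hpar⟩ := hc
      obtain ⟨C, hC0, hC⟩ := main_scaled m ℓ hm8 hℓm hpar d u hu α ρ ρ' β C₀ (by linarith) hβ0 hC₀ hρ
        (fun t ht z hz => by
          refine (h1 t ht z hz).trans_eq ?_
          congr 2
          rw [hβ]; ring)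
        (fun t ht => h3 t ht m hm8 hmk)
      exact ⟨C, hC0, fun _ _ _ _ => hC⟩
    · exact ⟨0, le_rfl, fun a b c e => absurd ⟨a, b, c, e⟩ hc⟩
  choose Cf hCf0 hCf using hmain
  have hS1 : 0 ≤ ∑ ℓ ∈ Finset.range (2 * k + 11), Cf 8 ℓ := Finset.sum_nonneg fun i _ => hCf0 8 i
  have hS2 : 0 ≤ ∑ ℓ ∈ Finset.range (2 * k + 11), Cf ℓ ℓ := Finset.sum_nonneg fun i _ => hCf0 i i
  refine ⟨β, hβ0, hβα, (∑ ℓ ∈ Finset.range (2 * k + 11), Cf 8 ℓ)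
    + (∑ ℓ ∈ Finset.range (2 * k + 11), Cf ℓ ℓ) + 1, by linarith, ?_⟩
  intro t ht
  refine ⟨fun ℓ hℓ z hz => ?_, fun ℓ hℓ8 hℓk z hz => ?_⟩
  · refine (hCf 8 ℓ le_rfl (by omega) hℓ (Or.inr (by decide)) t ht z hz).trans ?_
    have hle : Cf 8 ℓ ≤ ∑ ℓ ∈ Finset.range (2 * k + 11), Cf 8 ℓ :=
      Finset.single_le_sum (f := fun ℓ => Cf 8 ℓ) (fun i _ => hCf0 8 i)
        (Finset.mem_range.2 (by omega))
    refine mul_le_mul (by linarith) (le_of_eq ?_) (Real.exp_pos _).le (by linarith)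
    congr 2
    push_cast
    ring
  · refine (hCf ℓ ℓ hℓ8 hℓk le_rfl (Or.inl rfl) t ht z hz).trans ?_
    have hle : Cf ℓ ℓ ≤ ∑ ℓ ∈ Finset.range (2 * k + 11), Cf ℓ ℓ :=
      Finset.single_le_sum (f := fun ℓ => Cf ℓ ℓ) (fun i _ => hCf0 i i)
        (Finset.mem_range.2 (by omega))
    refine mul_le_mul (by linarith) (le_of_eq ?_) (Real.exp_pos _).le (by linarith)
    congr 2
    have : (ℓ : ℝ) + α ≠ 0 := by positivity
    field_simp
    ring
end
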